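/- arXiv:2302.06309 — 2 statements merged into one kernel-verified Lean document; each statement's English description precedes it below -/
import Mathlib

section
/- Let $X$ be an $n$-dimensional Gaussian vector with covariance kernel $K$, let $I_1, I_2 \subseteq \{1,\ldots,n\}$, and let $A_1 \in \sigma(I_1)$, $A_2 \in \sigma(I_2)$ be increasing events with $\Pr[X \in A_i] \in (0,1)$. If $K(i,j) \ge 0$ for all $i \in I_1$, $j \in I_2$, then $\min_{i \in I_1, j \in I_2} K(i,j) \le \mathrm{Cov}[T_{A_1}(X), T_{A_2}(X)] \le \max_{i \in I_1, j \in I_2} K(i,j)$, where $T_A(X) = \sup\{u : X - u\mathbf{1} \in A\}$ is the threshold random variable. -/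
open MeasureTheory ProbabilityTheory

/-- An event `A ⊆ ℝⁿ` is increasing if it is closed under adding coordinatewise
nonnegative vectors. -/
def IncreasingEvent {n : ℕ} (A : Set (Fin n → ℝ)) : Prop :=
  ∀ x ∈ A, ∀ v : Fin n → ℝ, (∀ i, 0 ≤ v i) → x + v ∈ A

/-- An event `A` is supported on `I` if membership is unchanged by modifying
coordinates outside `I`. -/
def SupportedOn {n : ℕ} (A : Set (Fin n → ℝ)) (I : Set (Fin n)) : Prop :=
  ∀ x y : Fin n → ℝ, (∀ i ∈ I, x i = y i) → (x ∈ A ↔ y ∈ A)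

/-- `X` is a Gaussian vector: every linear combination of coordinates is Gaussian. -/
def IsGaussianVector {Ω : Type*} [MeasureSpace Ω] {n : ℕ} (X : Ω → Fin n → ℝ) : Prop :=
  ∀ a : Fin n → ℝ, ∃ (m : ℝ) (v : NNReal),
    Measure.map (fun ω => ∑ i, a i * X ω i) ℙ = gaussianReal m v

/-- The threshold `T_A(x) = sup {u : x - u·𝟙 ∈ A}` of an increasing event. -/
noncomputable def thr {n : ℕ} (A : Set (Fin n → ℝ)) (x : Fin n → ℝ) : ℝ :=
  sSup {u : ℝ | (fun i => x i - u) ∈ A}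

/-- `‖K_{I₁,I₂}‖_∞ = max_{i ∈ I₁, j ∈ I₂} |K(i,j)|`. -/
noncomputable def kNorm {n : ℕ} (K : Fin n → Fin n → ℝ) (I1 I2 : Finset (Fin n)) : ℝ :=
  sSup {r : ℝ | ∃ i ∈ I1, ∃ j ∈ I2, r = |K i j|}

/-- A function on `ℝ^ι` that depends monotonically on the coordinates in `I` only and commutes with
adding a constant to all coordinates. -/
structure IsThresholdOn {ι : Type*} (I : Finset ι) (f : (ι → ℝ) → ℝ) : Prop where
  mono : ∀ x y : ι → ℝ, (∀ i ∈ I, x i ≤ y i) → f x ≤ f y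
  add_const : ∀ (x : ι → ℝ) (c : ℝ), f (fun i => x i + c) = f x + c

namespace IsThresholdOn

variable {ι : Type*} {I : Finset ι} {f : (ι → ℝ) → ℝ}

lemma add_le (hf : IsThresholdOn I f) {x y : ι → ℝ} {c : ℝ} (h : ∀ i ∈ I, x i + c ≤ y i) :
    f x + c ≤ f y := by
  rw [← hf.add_const]
  exact hf.mono _ _ h

lemma le_add (hf : IsThresholdOn I f) {x y : ι → ℝ} {c : ℝ} (h : ∀ i ∈ I, x i ≤ y i + c) :
    f x ≤ f y + c := by
  rw [← hf.add_const]
  exact hf.mono _ _ h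

lemma lipschitzWith [Fintype ι] (hf : IsThresholdOn I f) : LipschitzWith 1 f :=
  LipschitzWith.of_le_add fun x y => hf.le_add fun i _ => by
    have := (le_abs_self _).trans (dist_le_pi_dist x y i)
    linarith

lemma continuous [Fintype ι] (hf : IsThresholdOn I f) : Continuous f :=
  hf.lipschitzWith.continuous

lemma abs_le_add_norm [Fintype ι] (hf : IsThresholdOn I f) (x : ι → ℝ) : |f x| ≤ |f 0| + ‖x‖ := by
  have h := hf.lipschitzWith.dist_le_mul x 0
  rw [Real.dist_eq, dist_zero_right, NNReal.coe_one, one_mul] at h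
  have := abs_sub_abs_le_abs_sub (f x) (f 0)
  linarith

lemma comp_add (hf : IsThresholdOn I f) (v : ι → ℝ) : IsThresholdOn I (fun x => f (x + v)) where
  mono x y h := hf.mono _ _ fun i hi => by simpa using h i hi
  add_const x c := by
    rw [← hf.add_const]
    congr 1
    ext i
    simp only [Pi.add_apply]
    ring

lemma add_smul (hf : IsThresholdOn I f) (v : ι → ℝ) {c : ℝ} (hc : 0 < c) :
    IsThresholdOn I (fun x => c⁻¹ * f (v + c • x)) where
  mono x y h := by
    gcongr
    exact hf.mono _ _ fun i hi => by simpa using mul_le_mul_of_nonneg_left (h i hi) hc.le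
  add_const x d := by
    have : (v + c • fun i => x i + d) = fun i => (v + c • x) i + c * d := by
      ext i
      simp only [Pi.add_apply, Pi.smul_apply, smul_eq_mul]
      ring
    rw [this, hf.add_const]
    field_simp

lemma of_hasFDerivAt [Fintype ι] (hf : IsThresholdOn I f) {p : StrongDual ℝ (ι → ℝ)} {v : ι → ℝ}
    (hp : HasFDerivAt f p v) : IsThresholdOn I p := by
  have hlim (w : ι → ℝ) := hp.hasLineDerivAt w |>.tendsto_slope_zero_right
  refine ⟨fun x y h => ?_, fun x c => ?_⟩
  · refine le_of_tendsto_of_tendsto (hlim x) (hlim y) ?_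
    filter_upwards [self_mem_nhdsWithin] with t ht
    have ht : 0 < t := ht
    simp only [smul_eq_mul]
    gcongr
    exact hf.mono _ _ fun i hi => by simpa using mul_le_mul_of_nonneg_left (h i hi) ht.le
  · refine tendsto_nhds_unique (hlim _) (((hlim x).add_const c).congr' ?_)
    filter_upwards [self_mem_nhdsWithin] with t ht
    have ht : 0 < t := ht
    have : (v + t • fun i => x i + c) = fun i => (v + t • x) i + t * c := by
      ext i
      simp only [Pi.add_apply, Pi.smul_apply, smul_eq_mul]
      ring
    simp only [smul_eq_mul, this, hf.add_const]
    field_simp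
    ring

lemma dual_apply_const {p : StrongDual ℝ (ι → ℝ)} (hp : IsThresholdOn I p) (c : ℝ) :
    p (fun _ => c) = c := by
  simpa using hp.add_const 0 c

open scoped Convolution in
lemma exists_contDiff_approx [Fintype ι] (hf : IsThresholdOn I f) {ε : ℝ} (hε : 0 < ε) :
    ∃ g, IsThresholdOn I g ∧ ContDiff ℝ 1 g ∧ ∀ x, |g x - f x| ≤ ε := by
  let φ : ContDiffBump (0 : ι → ℝ) := ⟨ε / 2, ε, by positivity, by linarith⟩
  have hφ : Continuous (φ.normed volume) := φ.continuous_normed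
  have h_int (x : ι → ℝ) : Integrable (fun t => φ.normed volume t * f (x - t)) :=
    (hφ.mul (hf.continuous.comp (by fun_prop))).integrable_of_hasCompactSupport
      φ.hasCompactSupport_normed.mul_right
  refine ⟨φ.normed volume ⋆[ContinuousLinearMap.lsmul ℝ ℝ, volume] f, ⟨fun x y h => ?_,
    fun x c => ?_⟩, ?_, fun x => ?_⟩
  · refine integral_mono (h_int x) (h_int y) fun t => ?_
    exact mul_le_mul_of_nonneg_left (hf.mono _ _ fun i hi => by simpa using h i hi)
      (φ.nonneg_normed t)
  · have (t : ι → ℝ) : f ((fun i => x i + c) - t) = f (x - t) + c := by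
      rw [← hf.add_const]
      congr 1
      ext i
      simp only [Pi.sub_apply]
      ring
    simp only [convolution_def, ContinuousLinearMap.lsmul_apply, smul_eq_mul, this, mul_add]
    rw [integral_add (h_int x) (φ.integrable_normed.mul_const c), integral_mul_const,
      φ.integral_normed, one_mul]
  · exact φ.hasCompactSupport_normed.contDiff_convolution_left _ φ.contDiff_normed
      hf.continuous.locallyIntegrable
  · rw [← Real.dist_eq]
    refine φ.dist_normed_convolution_le hf.continuous.aestronglyMeasurable fun y hy => ?_
    refine (hf.lipschitzWith.dist_le_mul y x).trans ?_
    simpa using (Metric.mem_ball.1 hy).le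

end IsThresholdOn

lemma isThresholdOn_thr {n : ℕ} {A : Set (Fin n → ℝ)} {I : Finset (Fin n)}
    (hInc : IncreasingEvent A) (hSupp : SupportedOn A ↑I) (hne : A.Nonempty)
    (hne' : A ≠ Set.univ) : IsThresholdOn I (thr A) := by
  obtain ⟨a, ha⟩ := hne
  obtain ⟨b, hb⟩ := (Set.ne_univ_iff_exists_notMem A).1 hne'
  have hmono {x y : Fin n → ℝ} (h : ∀ i ∈ I, x i ≤ y i) (hx : x ∈ A) : y ∈ A := by
    classical
    refine (hSupp (x + fun i => if i ∈ I then y i - x i else 0) y fun i hi => ?_).1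
      (hInc x hx _ fun i => ?_)
    · have hi : i ∈ I := hi
      simp [hi]
    · split_ifs with hi
      · exact sub_nonneg.2 (h i hi)
      · exact le_rfl
  have hnonempty (x : Fin n → ℝ) : {u : ℝ | (fun i => x i - u) ∈ A}.Nonempty := by
    refine ⟨-‖a - x‖, hmono (fun i _ => ?_) ha⟩
    have := (le_abs_self _).trans (norm_le_pi_norm (a - x) i)
    simp only [Pi.sub_apply] at this
    linarith
  have hbdd (x : Fin n → ℝ) : BddAbove {u : ℝ | (fun i => x i - u) ∈ A} := by
    refine ⟨‖x - b‖, fun u hu => ?_⟩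
    by_contra! hlt
    refine hb (hmono (fun i _ => ?_) hu)
    have := (le_abs_self _).trans (norm_le_pi_norm (x - b) i)
    simp only [Pi.sub_apply] at this
    linarith
  refine ⟨fun x y h => csSup_le_csSup (hbdd y) (hnonempty x) fun u hu =>
    hmono (fun i hi => sub_le_sub_right (h i hi) u) hu, fun x c => ?_⟩
  have hle (x : Fin n → ℝ) (c : ℝ) : thr A (fun i => x i + c) ≤ thr A x + c := by
    refine csSup_le (hnonempty _) fun u hu => ?_
    rw [← sub_le_iff_le_add]
    refine le_csSup (hbdd x) ?_
    have : (fun i => x i - (u - c)) = fun i => x i + c - u := by ext; ring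
    simpa [this] using hu
  refine le_antisymm (hle x c) ?_
  have := hle (fun i => x i + c) (-c)
  simp only [add_neg_cancel_right] at this
  linarith

section Gaussian

variable {ι : Type*} [Fintype ι] {I J : Finset ι} {f g : (ι → ℝ) → ℝ} {μ : Measure (ι → ℝ)}
  [IsGaussian μ]

lemma integrable_mul_dual_of_isGaussian (p q : StrongDual ℝ (ι → ℝ)) :
    Integrable (fun x => p x * q x) μ :=
  (IsGaussian.memLp_dual μ p 2 (by simp)).integrable_mul (IsGaussian.memLp_dual μ q 2 (by simp))

lemma integrable_dual_smul_of_isGaussian (p : StrongDual ℝ (ι → ℝ)) :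
    Integrable (fun x => p x • x) μ :=
  memLp_one_iff_integrable.1 <|
    MemLp.smul (IsGaussian.memLp_two_id (μ := μ)) (IsGaussian.memLp_dual μ p 2 (by simp))

lemma integral_dual_mul_dual (p q : StrongDual ℝ (ι → ℝ)) :
    ∫ x, p x * q x ∂μ = q (∫ x, p x • x ∂μ) := by
  rw [← q.integral_comp_comm (integrable_dual_smul_of_isGaussian p)]
  simp

lemma IsThresholdOn.memLp_two (hf : IsThresholdOn I f) : MemLp f 2 μ := by
  refine MemLp.of_le ((memLp_const |f 0|).add (IsGaussian.memLp_two_id (μ := μ)).norm)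
    hf.continuous.aestronglyMeasurable (ae_of_all _ fun x => ?_)
  simp only [Pi.add_apply, id, Real.norm_eq_abs]
  exact (hf.abs_le_add_norm x).trans (le_abs_self _)

/-- A centered Gaussian measure is invariant under the reflection that flips the sign of a linear
functional `p` and fixes the linear functionals uncorrelated with `p`. -/
lemma map_reflection_eq_self (hμ : μ[id] = 0) (p : StrongDual ℝ (ι → ℝ))
    (hp : ∫ x, p x ^ 2 ∂μ ≠ 0) :
    μ.map (ContinuousLinearMap.id ℝ (ι → ℝ) -
      p.smulRight ((2 / ∫ x, p x ^ 2 ∂μ) • ∫ x, p x • x ∂μ)) = μ := by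
  set v := ∫ x, p x ^ 2 ∂μ with hv
  set c := ∫ x, p x • x ∂μ with hc
  have hmean (L : StrongDual ℝ (ι → ℝ)) : μ[L] = 0 := by
    rw [IsGaussian.integral_dual, show ∫ x, x ∂μ = 0 from hμ, map_zero]
  refine Measure.ext_of_charFunDual ?_
  ext L
  rw [charFunDual_map, IsGaussian.charFunDual_eq_of_integral_eq_zero hμ,
    IsGaussian.charFunDual_eq_of_integral_eq_zero hμ]
  congr 4
  rw [variance_of_integral_eq_zero (by fun_prop) (hmean _),
    variance_of_integral_eq_zero (by fun_prop) (hmean _)]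
  have hpp : p c = v := by
    rw [hc, ← integral_dual_mul_dual, hv]
    simp only [sq]
  have hexp (x : ι → ℝ) : (L.comp (ContinuousLinearMap.id ℝ (ι → ℝ) -
      p.smulRight ((2 / v) • c))) x ^ 2 =
      L x * L x - (4 / v * L c) * (p x * L x) + (4 / v ^ 2 * L c ^ 2) * (p x * p x) := by
    simp
    ring
  simp_rw [hexp]
  rw [integral_add, integral_sub, integral_const_mul, integral_const_mul,
    integral_dual_mul_dual p L, integral_dual_mul_dual p p, ← hc, hpp]
  · simp only [sq]
    field_simp
    ring
  · exact integrable_mul_dual_of_isGaussian _ _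
  · exact (integrable_mul_dual_of_isGaussian _ _).const_mul _
  · exact (integrable_mul_dual_of_isGaussian _ _).sub
      ((integrable_mul_dual_of_isGaussian _ _).const_mul _)
  · exact (integrable_mul_dual_of_isGaussian _ _).const_mul _

lemma IsThresholdOn.integrable_mul_dual (hf : IsThresholdOn I f) (p : StrongDual ℝ (ι → ℝ)) :
    Integrable (fun x => f x * p x) μ :=
  hf.memLp_two.integrable_mul (IsGaussian.memLp_dual μ p 2 (by simp))

/-- The covariance of a threshold function and a linear functional `p` lies between any bounds on
the covariances of the relevant coordinates with `p`. -/
lemma IsThresholdOn.integral_mul_dual_mem_Icc (hf : IsThresholdOn I f) (hI : I.Nonempty)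
    (hμ : μ[id] = 0) (p : StrongDual ℝ (ι → ℝ)) {m M : ℝ}
    (hp : ∀ i ∈ I, (∫ x, p x • x ∂μ) i ∈ Set.Icc m M) :
    ∫ x, f x * p x ∂μ ∈ Set.Icc m M := by
  set v := ∫ x, p x ^ 2 ∂μ with hv
  set c := ∫ x, p x • x ∂μ with hc
  by_cases hv0 : v = 0
  · have hp0 : p =ᵐ[μ] 0 := by
      have h := (integral_eq_zero_iff_of_nonneg (fun x => sq_nonneg (p x))
        (IsGaussian.memLp_dual μ p 2 (by simp)).integrable_sq).1 hv0
      filter_upwards [h] with x hx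
      simpa using hx
    have hc0 : c = 0 := by
      refine integral_eq_zero_of_ae ?_
      filter_upwards [hp0] with x hx
      simp [hx]
    have hf0 : ∫ x, f x * p x ∂μ = 0 := by
      refine integral_eq_zero_of_ae ?_
      filter_upwards [hp0] with x hx
      simp [hx]
    obtain ⟨i, hi⟩ := hI
    simpa [hf0, hc0] using hp i hi
  · have hvpos : 0 < v := lt_of_le_of_ne (integral_nonneg fun x => sq_nonneg (p x)) (Ne.symm hv0)
    set R : (ι → ℝ) →L[ℝ] (ι → ℝ) :=
      ContinuousLinearMap.id ℝ (ι → ℝ) - p.smulRight ((2 / v) • c) with hR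
    have hRμ : μ.map R = μ := map_reflection_eq_self hμ p hv0
    have hRx (x : ι → ℝ) (i : ι) : R x i = x i - 2 / v * p x * c i := by
      simp [hR]
      ring
    have hpc : p c = v := by
      rw [hc, ← integral_dual_mul_dual, hv]
      simp only [sq]
    have hpR (x : ι → ℝ) : p (R x) = - p x := by
      simp only [hR, sub_apply, ContinuousLinearMap.id_apply,
        ContinuousLinearMap.smulRight_apply, map_sub, map_smul, smul_eq_mul, hpc]
      field_simp
      ring
    have hfp := hf.integrable_mul_dual (μ := μ) p
    have hmeas : AEStronglyMeasurable (fun x => f x * p x) (μ.map R) := by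
      rw [hRμ]
      exact hfp.aestronglyMeasurable
    have hfR : Integrable (fun x => f (R x) * p x) μ := by
      have h := hfp
      rw [← hRμ, integrable_map_measure hmeas (by fun_prop)] at h
      simpa [Function.comp_def, hpR] using h.neg
    have hflip : ∫ x, f (R x) * p x ∂μ = - ∫ x, f x * p x ∂μ := by
      conv_rhs => rw [← hRμ, integral_map (by fun_prop) hmeas]
      simp [hpR, integral_neg]
    have htwo : 2 * ∫ x, f x * p x ∂μ = ∫ x, (f x - f (R x)) * p x ∂μ := by
      simp_rw [sub_mul]
      rw [integral_sub hfp hfR, hflip]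
      ring
    have hdiff : Integrable (fun x => (f x - f (R x)) * p x) μ := by
      simp only [sub_mul]
      exact hfp.sub hfR
    have hsq : Integrable (fun x => p x ^ 2) μ :=
      (IsGaussian.memLp_dual μ p 2 (by simp)).integrable_sq
    have hbound (x : ι → ℝ) : 2 / v * m * p x ^ 2 ≤ (f x - f (R x)) * p x ∧
        (f x - f (R x)) * p x ≤ 2 / v * M * p x ^ 2 := by
      rcases le_total 0 (p x) with hx | hx
      · have hk : 0 ≤ 2 / v * p x := by positivity
        have h1 : f (R x) + 2 / v * p x * m ≤ f x := hf.add_le fun i hi => by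
          have := mul_le_mul_of_nonneg_left (hp i hi).1 hk
          rw [hRx]
          linarith
        have h2 : f x ≤ f (R x) + 2 / v * p x * M := hf.le_add fun i hi => by
          have := mul_le_mul_of_nonneg_left (hp i hi).2 hk
          rw [hRx]
          linarith
        constructor <;> nlinarith
      · have hk : 2 / v * p x ≤ 0 := mul_nonpos_of_nonneg_of_nonpos (by positivity) hx
        have h1 : f x ≤ f (R x) + 2 / v * p x * m := hf.le_add fun i hi => by
          have := mul_le_mul_of_nonpos_left (hp i hi).1 hk
          rw [hRx]
          linarith
        have h2 : f (R x) + 2 / v * p x * M ≤ f x := hf.add_le fun i hi => by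
          have := mul_le_mul_of_nonpos_left (hp i hi).2 hk
          rw [hRx]
          linarith
        constructor <;> nlinarith
    have hlow := integral_mono (hsq.const_mul (2 / v * m)) hdiff fun x => (hbound x).1
    have hupp := integral_mono hdiff (hsq.const_mul (2 / v * M)) fun x => (hbound x).2
    rw [integral_const_mul, ← hv, ← htwo] at hlow hupp
    field_simp at hlow hupp
    constructor <;> linarith

lemma IsThresholdOn.hasDerivAt_integral_rotation (hf : IsThresholdOn I f) (hg : IsThresholdOn J g)
    (hgc : ContDiff ℝ 1 g) (θ : ℝ) :
    Integrable (fun z : (ι → ℝ) × (ι → ℝ) => f z.2 * fderiv ℝ g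
        (ContinuousLinearMap.rotation θ z).1 (ContinuousLinearMap.rotation θ z).2) (μ.prod μ) ∧
      HasDerivAt
        (fun θ => ∫ z, f z.2 * g (ContinuousLinearMap.rotation θ z).1 ∂(μ.prod μ))
        (∫ z, f z.2 * fderiv ℝ g (ContinuousLinearMap.rotation θ z).1
          (ContinuousLinearMap.rotation θ z).2 ∂(μ.prod μ)) θ := by
  have hfc := hf.continuous
  have hgc' := hg.continuous
  have hdg := hgc.continuous_fderiv one_ne_zero
  have hfi : Integrable f μ := hf.memLp_two.integrable one_le_two
  have hni : Integrable (fun x : ι → ℝ => ‖x‖) μ :=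
    (IsGaussian.memLp_two_id (μ := μ)).integrable one_le_two |>.norm
  have hfni : Integrable (fun x => |f x| * ‖x‖) μ :=
    hf.memLp_two.abs.integrable_mul (IsGaussian.memLp_two_id (μ := μ)).norm
  have hdom : Integrable (fun z : (ι → ℝ) × (ι → ℝ) => |f z.2| * (‖z.1‖ + ‖z.2‖))
      (μ.prod μ) := by
    refine ((hni.mul_prod hfi.abs).add (hfni.comp_snd μ)).congr (ae_of_all _ fun z => ?_)
    simp only [Pi.add_apply]
    ring
  have hrot (θ : ℝ) (z : (ι → ℝ) × (ι → ℝ)) :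
      ‖Real.cos θ • z.1 + Real.sin θ • z.2‖ ≤ ‖z.1‖ + ‖z.2‖ ∧
      ‖-Real.sin θ • z.1 + Real.cos θ • z.2‖ ≤ ‖z.1‖ + ‖z.2‖ := by
    have hc := Real.abs_cos_le_one θ
    have hs := Real.abs_sin_le_one θ
    constructor <;> refine (norm_add_le _ _).trans (add_le_add ?_ ?_) <;>
      rw [norm_smul] <;> refine mul_le_of_le_one_left (norm_nonneg _) ?_ <;> simpa
  refine hasDerivAt_integral_of_dominated_loc_of_deriv_le (s := Set.univ)
    (F' := fun θ z => f z.2 * fderiv ℝ g (ContinuousLinearMap.rotation θ z).1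
      (ContinuousLinearMap.rotation θ z).2)
    Filter.univ_mem (Filter.Eventually.of_forall fun θ => ?_) ?_ ?_
    (ae_of_all _ fun z θ _ => ?_) hdom (ae_of_all _ fun z θ _ => ?_)
  · exact Continuous.aestronglyMeasurable (by fun_prop)
  · refine ((hfi.abs.comp_snd μ).const_mul |g 0| |>.add hdom).mono'
      (Continuous.aestronglyMeasurable (by fun_prop)) (ae_of_all _ fun z => ?_)
    have h1 := (hg.abs_le_add_norm (ContinuousLinearMap.rotation θ z).1).trans
      (add_le_add_right (hrot θ z).1 _)
    have h2 := mul_le_mul_of_nonneg_left h1 (abs_nonneg (f z.2))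
    simp only [norm_mul, Real.norm_eq_abs, Pi.add_apply]
    linarith
  · exact Continuous.aestronglyMeasurable (by fun_prop)
  · rw [norm_mul, Real.norm_eq_abs]
    refine mul_le_mul_of_nonneg_left ?_ (abs_nonneg _)
    refine ((fderiv ℝ g _).le_of_opNorm_le (norm_fderiv_le_of_lipschitz ℝ hg.lipschitzWith) _).trans
      ?_
    rw [NNReal.coe_one, one_mul]
    exact (hrot θ z).2
  · refine HasDerivAt.const_mul _ ?_
    have hz : HasDerivAt (fun θ => (ContinuousLinearMap.rotation θ z).1)
        (ContinuousLinearMap.rotation θ z).2 θ := by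
      simp only [ContinuousLinearMap.rotation_apply]
      exact ((Real.hasDerivAt_cos θ).smul_const z.1).add ((Real.hasDerivAt_sin θ).smul_const z.2)
    exact ((hgc.differentiable one_ne_zero) _).hasFDerivAt.comp_hasDerivAt θ hz

lemma IsThresholdOn.integral_rotation_fderiv_mem_Icc (hf : IsThresholdOn I f)
    (hg : IsThresholdOn J g) (hgc : ContDiff ℝ 1 g) (hI : I.Nonempty) (hμ : μ[id] = 0)
    {m M : ℝ} (hK : ∀ i ∈ I, ∀ j ∈ J, ∫ x, x i * x j ∂μ ∈ Set.Icc m M) {θ : ℝ}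
    (hθ : 0 < Real.cos θ) :
    ∫ z, f z.2 * fderiv ℝ g (ContinuousLinearMap.rotation θ z).1
      (ContinuousLinearMap.rotation θ z).2 ∂(μ.prod μ) ∈
        Set.Icc (m * Real.cos θ) (M * Real.cos θ) := by
  have hfc := hf.continuous
  have hdg := hgc.continuous_fderiv one_ne_zero
  set h : (ι → ℝ) × (ι → ℝ) → ℝ := fun z =>
    f (Real.sin θ • z.1 + Real.cos θ • z.2) * fderiv ℝ g z.1 z.2 with h_def
  have hh (z : (ι → ℝ) × (ι → ℝ)) : f z.2 * fderiv ℝ g (ContinuousLinearMap.rotation θ z).1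
      (ContinuousLinearMap.rotation θ z).2 = h (ContinuousLinearMap.rotation θ z) := by
    have : Real.sin θ • (ContinuousLinearMap.rotation θ z).1 +
        Real.cos θ • (ContinuousLinearMap.rotation θ z).2 = z.2 := by
      ext i
      simp only [ContinuousLinearMap.rotation_apply, Pi.add_apply, Pi.smul_apply, smul_eq_mul]
      linear_combination (z.2 i) * Real.sin_sq_add_cos_sq θ
    rw [h_def]
    simp only [this]
  have hmeas (ν : Measure ((ι → ℝ) × (ι → ℝ))) : AEStronglyMeasurable h ν :=
    Continuous.aestronglyMeasurable (by fun_prop)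
  have h_int := (hf.hasDerivAt_integral_rotation (μ := μ) hg hgc θ).1
  simp only [hh] at h_int ⊢
  have h_int : Integrable h (μ.prod μ) := by
    rw [← IsGaussian.map_rotation_eq_self hμ θ]
    exact (integrable_map_measure (hmeas _) (by fun_prop)).2 h_int
  rw [← integral_map (by fun_prop) (hmeas _), IsGaussian.map_rotation_eq_self hμ θ,
    integral_prod _ h_int]
  have hinner (v : ι → ℝ) :
      ∫ w, h (v, w) ∂μ ∈ Set.Icc (m * Real.cos θ) (M * Real.cos θ) := by
    set p := fderiv ℝ g v with hp_def
    have hp : IsThresholdOn J p :=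
      hg.of_hasFDerivAt ((hgc.differentiable one_ne_zero) v).hasFDerivAt
    have hcov : ∀ i ∈ I, (∫ x, p x • x ∂μ) i ∈ Set.Icc m M := by
      intro i hi
      have heq : (∫ x, p x • x ∂μ) i = p (∫ x, x i • x ∂μ) := by
        refine (integral_dual_mul_dual p (ContinuousLinearMap.proj (φ := fun _ => ℝ) i)).symm.trans
          (Eq.trans ?_ (integral_dual_mul_dual (ContinuousLinearMap.proj (φ := fun _ => ℝ) i) p))
        simp only [mul_comm]
      have hcoord (j : ι) : (∫ x, x i • x ∂μ) j = ∫ x, x i * x j ∂μ :=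
        (integral_dual_mul_dual (ContinuousLinearMap.proj (φ := fun _ => ℝ) i)
          (ContinuousLinearMap.proj (φ := fun _ => ℝ) j)).symm
      rw [heq, ← hp.dual_apply_const m, ← hp.dual_apply_const M]
      refine ⟨hp.mono _ _ fun j hj => ?_, hp.mono _ _ fun j hj => ?_⟩ <;> rw [hcoord]
      · exact (hK i hi j hj).1
      · exact (hK i hi j hj).2
    have key := (hf.add_smul (Real.sin θ • v) hθ).integral_mul_dual_mem_Icc hI hμ p hcov
    have heq : ∫ w, h (v, w) ∂μ = (∫ w, (Real.cos θ)⁻¹ *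
        f (Real.sin θ • v + Real.cos θ • w) * p w ∂μ) * Real.cos θ := by
      rw [← integral_mul_const]
      congr 1
      ext w
      simp only [h_def, ← hp_def]
      field_simp
    rw [heq]
    exact ⟨mul_le_mul_of_nonneg_right key.1 hθ.le, mul_le_mul_of_nonneg_right key.2 hθ.le⟩
  constructor
  · simpa using integral_mono (integrable_const _) h_int.integral_prod_left fun v => (hinner v).1
  · simpa using integral_mono h_int.integral_prod_left (integrable_const _) fun v => (hinner v).2

lemma IsThresholdOn.covariance_mem_Icc_of_contDiff (hf : IsThresholdOn I f)
    (hg : IsThresholdOn J g) (hgc : ContDiff ℝ 1 g) (hI : I.Nonempty) (hμ : μ[id] = 0)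
    {m M : ℝ} (hK : ∀ i ∈ I, ∀ j ∈ J, ∫ x, x i * x j ∂μ ∈ Set.Icc m M) :
    ∫ x, f x * g x ∂μ - (∫ x, f x ∂μ) * ∫ x, g x ∂μ ∈ Set.Icc m M := by
  set φ : ℝ → ℝ := fun θ => ∫ z, f z.2 * g (ContinuousLinearMap.rotation θ z).1 ∂(μ.prod μ)
    with hφ
  have hφ0 : φ 0 = (∫ x, f x ∂μ) * ∫ x, g x ∂μ := by
    simp only [hφ, ContinuousLinearMap.rotation_apply, Real.cos_zero, Real.sin_zero, one_smul,
      zero_smul, add_zero]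
    rw [mul_comm, ← integral_prod_mul]
    simp only [mul_comm]
  have hφ1 : φ (Real.pi / 2) = ∫ x, f x * g x ∂μ := by
    simp only [hφ, ContinuousLinearMap.rotation_apply, Real.cos_pi_div_two, Real.sin_pi_div_two,
      one_smul, zero_smul, zero_add]
    rw [integral_fun_snd (fun x => f x * g x)]
    simp
  have hderiv (θ : ℝ) := (hf.hasDerivAt_integral_rotation (μ := μ) hg hgc θ).2
  have hpi := Real.pi_pos
  have hbound {θ : ℝ} (hθ : θ ∈ interior (Set.Icc 0 (Real.pi / 2))) := by
    rw [interior_Icc] at hθ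
    exact hf.integral_rotation_fderiv_mem_Icc hg hgc hI hμ hK
      (Real.cos_pos_of_mem_Ioo ⟨by linarith [hθ.1], hθ.2⟩)
  have h0 : (0 : ℝ) ∈ Set.Icc 0 (Real.pi / 2) := ⟨le_rfl, by positivity⟩
  have h1 : Real.pi / 2 ∈ Set.Icc 0 (Real.pi / 2) := ⟨by positivity, le_rfl⟩
  have hlow (c θ : ℝ) := (hderiv θ).sub ((Real.hasDerivAt_sin θ).const_mul c)
  have hm : MonotoneOn (fun θ => φ θ - m * Real.sin θ) (Set.Icc 0 (Real.pi / 2)) := by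
    refine monotoneOn_of_hasDerivWithinAt_nonneg (convex_Icc _ _)
      (fun θ _ => (hlow m θ).continuousAt.continuousWithinAt)
      (fun θ _ => (hlow m θ).hasDerivWithinAt) fun θ hθ => ?_
    exact sub_nonneg.2 (hbound hθ).1
  have hM : AntitoneOn (fun θ => φ θ - M * Real.sin θ) (Set.Icc 0 (Real.pi / 2)) := by
    refine antitoneOn_of_hasDerivWithinAt_nonpos (convex_Icc _ _)
      (fun θ _ => (hlow M θ).continuousAt.continuousWithinAt)
      (fun θ _ => (hlow M θ).hasDerivWithinAt) fun θ hθ => ?_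
    exact sub_nonpos.2 (hbound hθ).2
  have hm' := hm h0 h1 h0.2
  have hM' := hM h0 h1 h0.2
  simp only [hφ0, hφ1, Real.sin_zero, Real.sin_pi_div_two] at hm' hM'
  constructor <;> linarith

lemma IsThresholdOn.covariance_mem_Icc (hf : IsThresholdOn I f)
    (hg : IsThresholdOn J g) (hI : I.Nonempty) (hμ : μ[id] = 0)
    {m M : ℝ} (hK : ∀ i ∈ I, ∀ j ∈ J, ∫ x, x i * x j ∂μ ∈ Set.Icc m M) :
    ∫ x, f x * g x ∂μ - (∫ x, f x ∂μ) * ∫ x, g x ∂μ ∈ Set.Icc m M := by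
  set C := ∫ x, |f x - ∫ y, f y ∂μ| ∂μ with hC
  have hC0 : 0 ≤ C := integral_nonneg fun x => abs_nonneg _
  have hcenter {g : (ι → ℝ) → ℝ} (hg : IsThresholdOn J g) :
      ∫ x, f x * g x ∂μ - (∫ x, f x ∂μ) * ∫ x, g x ∂μ =
        ∫ x, (f x - ∫ y, f y ∂μ) * g x ∂μ := by
    simp only [sub_mul]
    rw [← integral_const_mul]
    exact (integral_sub (hf.memLp_two.integrable_mul hg.memLp_two)
      ((hg.memLp_two.integrable one_le_two).const_mul _)).symm
  have hfC : MemLp (fun x => f x - ∫ y, f y ∂μ) 2 μ := hf.memLp_two.sub (memLp_const _)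
  have happrox (ε : ℝ) (hε : 0 < ε) :
      ∫ x, f x * g x ∂μ - (∫ x, f x ∂μ) * ∫ x, g x ∂μ ∈ Set.Icc (m - ε) (M + ε) := by
    obtain ⟨g', hg', hgc', hgg'⟩ := hg.exists_contDiff_approx (ε := ε / (C + 1)) (by positivity)
    have key := hf.covariance_mem_Icc_of_contDiff hg' hgc' hI hμ hK
    have hdist : |∫ x, (f x - ∫ y, f y ∂μ) * g' x ∂μ - ∫ x, (f x - ∫ y, f y ∂μ) * g x ∂μ| ≤ ε := by
      have hsub := integral_sub (hfC.integrable_mul (hg'.memLp_two (μ := μ)))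
        (hfC.integrable_mul (hg.memLp_two (μ := μ)))
      simp only [Pi.mul_apply] at hsub
      rw [← hsub, ← Real.norm_eq_abs]
      calc _ ≤ ∫ x, |f x - ∫ y, f y ∂μ| * (ε / (C + 1)) ∂μ := by
            refine norm_integral_le_of_norm_le
              ((hfC.integrable one_le_two).abs.mul_const _) (ae_of_all _ fun x => ?_)
            rw [← mul_sub, norm_mul]
            exact mul_le_mul_of_nonneg_left (hgg' x) (abs_nonneg _)
        _ = ε * (C / (C + 1)) := by
            rw [integral_mul_const, ← hC]
            ring
        _ ≤ ε := mul_le_of_le_one_right hε.le ((div_le_one (by positivity)).2 (by linarith))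
    rw [hcenter hg'] at key
    rw [hcenter hg]
    have := abs_le.1 hdist
    exact ⟨by linarith [key.1], by linarith [key.2]⟩
  exact ⟨le_of_forall_pos_le_add fun ε hε => by linarith [(happrox ε hε).1],
    le_of_forall_pos_le_add fun ε hε => (happrox ε hε).2⟩

end Gaussian

lemma IsGaussianVector.aemeasurable {Ω : Type*} [MeasureSpace Ω] {n : ℕ} {X : Ω → Fin n → ℝ}
    (hX : IsGaussianVector X) : AEMeasurable X ℙ := by
  refine aemeasurable_pi_lambda _ fun i => ?_
  obtain ⟨m, v, h⟩ := hX (Pi.single i 1)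
  have : AEMeasurable (fun ω => ∑ j, (Pi.single i 1 : Fin n → ℝ) j * X ω j) ℙ :=
    AEMeasurable.of_map_ne_zero (h ▸ IsProbabilityMeasure.ne_zero _)
  simpa [Pi.single_apply] using this

lemma IsGaussianVector.isGaussian_map {Ω : Type*} [MeasureSpace Ω] {n : ℕ} {X : Ω → Fin n → ℝ}
    (hX : IsGaussianVector X) : IsGaussian (Measure.map X ℙ) := by
  refine isGaussian_of_map_eq_gaussianReal fun L => ?_
  obtain ⟨m, v, h⟩ := hX fun i => L (Pi.single i 1)
  refine ⟨m, v, ?_⟩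
  rw [← h, AEMeasurable.map_map_of_aemeasurable (by fun_prop) hX.aemeasurable]
  congr 1
  ext ω
  simp only [Function.comp_apply]
  conv_lhs => rw [← LinearMap.sum_single_apply (φ := fun _ : Fin n => ℝ) (X ω), map_sum]
  refine Finset.sum_congr rfl fun i _ => ?_
  rw [mul_comm, ← smul_eq_mul, ← map_smul]
  congr 1
  ext j
  simp [Pi.single_apply]

theorem stmt3 {n : ℕ} {Ω : Type*} [MeasureSpace Ω]
    [IsProbabilityMeasure (ℙ : Measure Ω)]
    (X : Ω → Fin n → ℝ) (hX : IsGaussianVector X)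
    (K : Fin n → Fin n → ℝ)
    (hK : ∀ i j, K i j = ∫ ω, X ω i * X ω j ∂ℙ -
      (∫ ω, X ω i ∂ℙ) * (∫ ω, X ω j ∂ℙ))
    (I1 I2 : Finset (Fin n)) (hI1 : I1.Nonempty) (hI2 : I2.Nonempty)
    (A1 A2 : Set (Fin n → ℝ))
    (hInc1 : IncreasingEvent A1) (hInc2 : IncreasingEvent A2)
    (hSupp1 : SupportedOn A1 ↑I1) (hSupp2 : SupportedOn A2 ↑I2)
    (h01 : 0 < ℙ {ω | X ω ∈ A1}) (h11 : ℙ {ω | X ω ∈ A1} < 1)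
    (h02 : 0 < ℙ {ω | X ω ∈ A2}) (h12 : ℙ {ω | X ω ∈ A2} < 1)
    (hpos : ∀ i ∈ I1, ∀ j ∈ I2, 0 ≤ K i j) :
    (I1 ×ˢ I2).inf' (hI1.product hI2) (fun p => K p.1 p.2) ≤
        (∫ ω, thr A1 (X ω) * thr A2 (X ω) ∂ℙ) -
          (∫ ω, thr A1 (X ω) ∂ℙ) * (∫ ω, thr A2 (X ω) ∂ℙ) ∧
      (∫ ω, thr A1 (X ω) * thr A2 (X ω) ∂ℙ) -
          (∫ ω, thr A1 (X ω) ∂ℙ) * (∫ ω, thr A2 (X ω) ∂ℙ) ≤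
        (I1 ×ˢ I2).sup' (hI1.product hI2) (fun p => K p.1 p.2) := by
  have hthr {A : Set (Fin n → ℝ)} {I : Finset (Fin n)} (hInc : IncreasingEvent A)
      (hSupp : SupportedOn A ↑I) (h0 : 0 < ℙ {ω | X ω ∈ A}) (h1 : ℙ {ω | X ω ∈ A} < 1) :
      IsThresholdOn I (thr A) := by
    refine isThresholdOn_thr hInc hSupp (Set.nonempty_iff_ne_empty.2 ?_) ?_
    · rintro rfl
      simp at h0
    · rintro rfl
      simp at h1
  have hf := hthr hInc1 hSupp1 h01 h11
  have hg := hthr hInc2 hSupp2 h02 h12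
  have : IsGaussian (Measure.map X ℙ) := hX.isGaussian_map
  set a := ∫ x, x ∂(Measure.map X ℙ) with ha
  set μ := (Measure.map X ℙ).map (fun x => x + -a) with hμ
  have hcenter : μ[id] = 0 := by
    rw [hμ, integral_map (by fun_prop) (by fun_prop)]
    simp only [id]
    rw [integral_add (f := fun x => x) (IsGaussian.memLp_two_id.integrable one_le_two)
      (integrable_const _), ← ha]
    simp
  have htransfer {h : (Fin n → ℝ) → ℝ} (hc : Continuous h) :
      ∫ ω, h (X ω) ∂ℙ = ∫ x, h (x + a) ∂μ := by
    rw [hμ, integral_map (by fun_prop) (Continuous.aestronglyMeasurable (by fun_prop)),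
      integral_map hX.aemeasurable (Continuous.aestronglyMeasurable (by fun_prop))]
    simp
  have hmean (i : Fin n) : ∫ x, x i ∂μ = 0 := by
    have := IsGaussian.integral_dual (μ := μ) (ContinuousLinearMap.proj (φ := fun _ => ℝ) i)
    rw [show ∫ x, x ∂μ = 0 from hcenter, map_zero] at this
    exact this
  have h_int (i : Fin n) : Integrable (fun x : Fin n → ℝ => x i) μ :=
    IsGaussian.integrable_dual μ (ContinuousLinearMap.proj (φ := fun _ => ℝ) i)
  have hprod_int (i j : Fin n) : Integrable (fun x : Fin n → ℝ => x i * x j) μ :=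
    integrable_mul_dual_of_isGaussian (ContinuousLinearMap.proj (φ := fun _ => ℝ) i)
      (ContinuousLinearMap.proj (φ := fun _ => ℝ) j)
  have hcov (i j : Fin n) : ∫ x, x i * x j ∂μ = K i j := by
    have hshift (i : Fin n) : ∫ ω, X ω i ∂ℙ = a i := by
      rw [htransfer (h := fun x => x i) (by fun_prop)]
      simp only [Pi.add_apply]
      rw [integral_add (h_int i) (integrable_const _), hmean]
      simp
    rw [hK, hshift, hshift, htransfer (h := fun x => x i * x j) (by fun_prop)]
    have hexp (x : Fin n → ℝ) : (x + a) i * (x + a) j =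
        x i * x j + x i * a j + x j * a i + a i * a j := by
      simp only [Pi.add_apply]
      ring
    simp_rw [hexp]
    have hi := (hprod_int i j).fun_add ((h_int i).mul_const (a j))
    have hj := hi.fun_add ((h_int j).mul_const (a i))
    rw [integral_add hj (integrable_const _), integral_add hi ((h_int j).mul_const _),
      integral_add (hprod_int i j) ((h_int i).mul_const _), integral_mul_const,
      integral_mul_const, hmean, hmean]
    simp
  rw [htransfer (hf.continuous.fun_mul hg.continuous), htransfer hf.continuous,
    htransfer hg.continuous]
  refine (hf.comp_add a).covariance_mem_Icc (hg.comp_add a) hI1 hcenter fun i hi j hj => ?_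
  rw [hcov]
  have hmem : (i, j) ∈ I1 ×ˢ I2 := Finset.mk_mem_product hi hj
  exact ⟨Finset.inf'_le (fun p : Fin n × Fin n => K p.1 p.2) hmem,
    Finset.le_sup' (fun p : Fin n × Fin n => K p.1 p.2) hmem⟩
end

section
/- There exists a universal constant $c > 0$ (e.g. $c = 36$) such that for every $n$-dimensional Gaussian vector $X$ with covariance $K$, all $I_1, I_2 \subseteq \{1,\ldots,n\}$, all increasing events $A_1 \in \sigma(I_1)$ and $A_2 \in \sigma(I_2)$, and all $\varepsilon > 0$: $\Pr[X \in A_1 \cap A_2] - \Pr[X + \varepsilon\mathbf{1} \in A_1]\Pr[X + \varepsilon\mathbf{1} \in A_2] \le c\,\|K_{I_1,I_2}\|_\infty / \varepsilon^2$, where $\|K_{I_1,I_2}\|_\infty = \max_{i \in I_1, j \in I_2} |K(i,j)|$. -/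
open MeasureTheory ProbabilityTheory

/-- A continuous `[0, 1]`-valued function `f` with continuous derivative `a` and second-order
Taylor remainder controlled by `B`, which is nondecreasing along directions that are nonnegative
on `I`, and whose slope in the diagonal direction is at most `L`. -/
structure IsSmoothTest {n : ℕ} (I : Finset (Fin n)) (L B : ℝ) (f : (Fin n → ℝ) → ℝ)
    (a : (Fin n → ℝ) → (Fin n → ℝ) →L[ℝ] ℝ) : Prop where
  nonneg : ∀ x, 0 ≤ f x
  le_one : ∀ x, f x ≤ 1
  cont : Continuous f
  cont_deriv : Continuous a
  deriv_nonneg : ∀ x v, (∀ i ∈ I, 0 ≤ v i) → 0 ≤ a x v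
  deriv_one_le : ∀ x, a x 1 ≤ L
  taylor : ∀ x v, |f (x + v) - f x - a x v| ≤ B * ‖v‖ ^ 2

namespace IsSmoothTest

variable {n : ℕ} {I J : Finset (Fin n)} {L B : ℝ} {f g : (Fin n → ℝ) → ℝ}
  {a b : (Fin n → ℝ) → (Fin n → ℝ) →L[ℝ] ℝ}

lemma slope_nonneg (hf : IsSmoothTest I L B f a) : 0 ≤ L :=
  (hf.deriv_nonneg 0 1 (by simp)).trans (hf.deriv_one_le 0)

lemma abs_deriv_le (hf : IsSmoothTest I L B f a) (x v : Fin n → ℝ) : |a x v| ≤ L * ‖v‖ := by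
  have hv : ∀ i, |v i| ≤ ‖v‖ := fun i => norm_le_pi_norm v i
  have h1 := hf.deriv_nonneg x (‖v‖ • 1 - v) fun i _ => by
    have := le_abs_self (v i); simp; linarith [hv i]
  have h2 := hf.deriv_nonneg x (‖v‖ • 1 + v) fun i _ => by
    have := neg_abs_le (v i); simp; linarith [hv i]
  rw [map_sub, map_smul, smul_eq_mul] at h1
  rw [map_add, map_smul, smul_eq_mul] at h2
  have h3 := mul_le_mul_of_nonneg_left (hf.deriv_one_le x) (norm_nonneg v)
  rw [abs_le]
  constructor <;> linarith

lemma norm_deriv_le (hf : IsSmoothTest I L B f a) (x : Fin n → ℝ) : ‖a x‖ ≤ L :=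
  ContinuousLinearMap.opNorm_le_bound _ hf.slope_nonneg fun v => hf.abs_deriv_le x v

lemma integrable (hf : IsSmoothTest I L B f a) (ρ : Measure (Fin n → ℝ)) [IsFiniteMeasure ρ]
    {φ : (Fin n → ℝ) → (Fin n → ℝ)} (hφ : Continuous φ) : Integrable (fun y => f (φ y)) ρ :=
  Integrable.of_bound (hf.cont.comp hφ).aestronglyMeasurable 1 <| ae_of_all _ fun y => by
    rw [Real.norm_eq_abs, abs_of_nonneg (hf.nonneg _)]; exact hf.le_one _

lemma integrable_mul (hf : IsSmoothTest I L B f a) (hg : IsSmoothTest J L B g b)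
    (ρ : Measure (Fin n → ℝ)) [IsFiniteMeasure ρ]
    {φ : (Fin n → ℝ) → (Fin n → ℝ)} (hφ : Continuous φ) :
    Integrable (fun y => f (φ y) * g (φ y)) ρ :=
  Integrable.of_bound ((hf.cont.comp hφ).mul (hg.cont.comp hφ)).aestronglyMeasurable 1 <|
    ae_of_all _ fun y => by
      rw [Real.norm_eq_abs, abs_of_nonneg (mul_nonneg (hf.nonneg _) (hg.nonneg _))]
      exact mul_le_one₀ (hf.le_one _) (hg.nonneg _) (hg.le_one _)

lemma integrable_deriv (hf : IsSmoothTest I L B f a) (ρ : Measure (Fin n → ℝ)) [IsFiniteMeasure ρ]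
    (x : Fin n → ℝ) : Integrable (fun y => a (x + y)) ρ :=
  Integrable.of_bound (hf.cont_deriv.comp (by fun_prop)).aestronglyMeasurable L <|
    ae_of_all _ fun y => hf.norm_deriv_le _

lemma average (hf : IsSmoothTest I L B f a) (ρ : Measure (Fin n → ℝ)) [IsProbabilityMeasure ρ] :
    IsSmoothTest I L B (fun x => ∫ y, f (x + y) ∂ρ) (fun x => ∫ y, a (x + y) ∂ρ) where
  nonneg x := integral_nonneg fun y => hf.nonneg _
  le_one x := by
    have := integral_mono (hf.integrable ρ (φ := fun y => x + y) (by fun_prop))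
      (integrable_const (1 : ℝ)) fun y => hf.le_one _
    simpa using this
  cont := by
    refine continuous_of_dominated (bound := fun _ => 1)
      (fun x => (hf.cont.comp (by fun_prop)).aestronglyMeasurable) (fun x => ae_of_all _ fun y => ?_)
      (integrable_const _) (ae_of_all _ fun y => hf.cont.comp (by fun_prop))
    rw [Real.norm_eq_abs, abs_of_nonneg (hf.nonneg _)]; exact hf.le_one _
  cont_deriv := by
    refine continuous_of_dominated (bound := fun _ => L)
      (fun x => (hf.cont_deriv.comp (by fun_prop)).aestronglyMeasurable)
      (fun x => ae_of_all _ fun y => hf.norm_deriv_le _)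
      (integrable_const _) (ae_of_all _ fun y => hf.cont_deriv.comp (by fun_prop))
  deriv_nonneg x v hv := by
    rw [ContinuousLinearMap.integral_apply (hf.integrable_deriv ρ x)]
    exact integral_nonneg fun y => hf.deriv_nonneg _ v hv
  deriv_one_le x := by
    rw [ContinuousLinearMap.integral_apply (hf.integrable_deriv ρ x)]
    have := integral_mono ((hf.integrable_deriv ρ x).apply_continuousLinearMap 1)
      (integrable_const L) fun y => hf.deriv_one_le (x + y)
    simpa using this
  taylor x v := by
    have h1 := hf.integrable ρ (φ := fun y => x + v + y) (by fun_prop)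
    have h2 := hf.integrable ρ (φ := fun y => x + y) (by fun_prop)
    have h3 := (hf.integrable_deriv ρ x).apply_continuousLinearMap v
    rw [ContinuousLinearMap.integral_apply (hf.integrable_deriv ρ x), ← integral_sub h1 h2,
      ← integral_sub (f := fun y => f (x + v + y) - f (x + y)) (h1.sub h2) h3]
    have := norm_integral_le_of_norm_le_const (μ := ρ)
      (f := fun y => f (x + v + y) - f (x + y) - a (x + y) v) (C := B * ‖v‖ ^ 2)
      (ae_of_all _ fun y => by
        have := hf.taylor (x + y) v
        rwa [add_right_comm, ← Real.norm_eq_abs] at this)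
    simpa using this

/-- The bilinear form of the second moments of `ν`, evaluated on the derivatives, only sees the
entries indexed by `I × J`. -/
lemma integral_deriv_mul_le (hf : IsSmoothTest I L B f a) (hg : IsSmoothTest J L B g b)
    {ν : Measure (Fin n → ℝ)} (hν : ∀ i j, Integrable (fun y => y i * y j) ν) {κ : ℝ}
    (hκ : ∀ i ∈ I, ∀ j ∈ J, |∫ y, y i * y j ∂ν| ≤ κ) (hκ0 : 0 ≤ κ) (x : Fin n → ℝ) :
    ∫ y, a x y * b x y ∂ν ≤ κ * L ^ 2 := by
  have expand : ∀ (T : (Fin n → ℝ) →L[ℝ] ℝ) (y : Fin n → ℝ),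
      T y = ∑ i, y i * T (Pi.single i 1) := fun T y => by
    conv_lhs => rw [pi_eq_sum_univ' y, map_sum]
    refine Finset.sum_congr rfl fun i _ => ?_
    rw [map_smul, smul_eq_mul]
  have pos : ∀ {K : Finset (Fin n)} {h : (Fin n → ℝ) → ℝ} {c}, IsSmoothTest K L B h c →
      ∀ i, 0 ≤ c x (Pi.single i 1) := fun hh i => hh.deriv_nonneg x _ fun j _ => by
    by_cases hij : j = i <;> simp [hij]
  have zero : ∀ {K : Finset (Fin n)} {h : (Fin n → ℝ) → ℝ} {c}, IsSmoothTest K L B h c →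
      ∀ i ∉ K, c x (Pi.single i 1) = 0 := fun {K h c} hh i hi => by
    have := hh.deriv_nonneg x (-Pi.single i 1) fun j hj => by
      have : j ≠ i := by rintro rfl; exact hi hj
      simp [this]
    rw [map_neg] at this
    linarith [pos hh i]
  have tot : ∀ {K : Finset (Fin n)} {h : (Fin n → ℝ) → ℝ} {c}, IsSmoothTest K L B h c →
      ∑ i, c x (Pi.single i 1) ≤ L := fun {K h c} hh => by
    have := hh.deriv_one_le x
    rw [expand] at this
    simpa using this
  have hκ' : ∀ i j, a x (Pi.single i 1) * b x (Pi.single j 1) * ∫ y, y i * y j ∂ν ≤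
      a x (Pi.single i 1) * b x (Pi.single j 1) * κ := fun i j => by
    by_cases hi : i ∈ I
    · by_cases hj : j ∈ J
      · exact mul_le_mul_of_nonneg_left ((le_abs_self _).trans (hκ i hi j hj))
          (mul_nonneg (pos hf i) (pos hg j))
      · simp [zero hg j hj]
    · simp [zero hf i hi]
  calc ∫ y, a x y * b x y ∂ν
      = ∫ y, ∑ i, ∑ j, a x (Pi.single i 1) * b x (Pi.single j 1) * (y i * y j) ∂ν := by
        congr 1; ext y
        rw [expand (a x), expand (b x), Finset.sum_mul_sum]
        refine Finset.sum_congr rfl fun i _ => Finset.sum_congr rfl fun j _ => by ring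
    _ = ∑ i, ∑ j, a x (Pi.single i 1) * b x (Pi.single j 1) * ∫ y, y i * y j ∂ν := by
        rw [integral_finsetSum _ fun i _ =>
          integrable_finsetSum _ fun j _ => (hν i j).const_mul _]
        refine Finset.sum_congr rfl fun i _ => ?_
        rw [integral_finsetSum _ fun j _ => (hν i j).const_mul _]
        exact Finset.sum_congr rfl fun j _ => integral_const_mul _ _
    _ ≤ ∑ i, ∑ j, a x (Pi.single i 1) * b x (Pi.single j 1) * κ :=
        Finset.sum_le_sum fun i _ => Finset.sum_le_sum fun j _ => hκ' i j
    _ = κ * ((∑ i, a x (Pi.single i 1)) * ∑ j, b x (Pi.single j 1)) := by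
        rw [Finset.sum_mul_sum, Finset.mul_sum]
        refine Finset.sum_congr rfl fun i _ => ?_
        rw [Finset.mul_sum]
        exact Finset.sum_congr rfl fun j _ => by ring
    _ ≤ κ * L ^ 2 := by
        rw [sq]
        gcongr
        · exact Finset.sum_nonneg fun j _ => pos hg j
        · exact hf.slope_nonneg
        · exact tot hf
        · exact tot hg

end IsSmoothTest

/-- The covariance of `f (x + Y)` and `g (x + Y)` for `Y` distributed as `ρ`. -/
noncomputable def shiftCov {n : ℕ} (ρ : Measure (Fin n → ℝ)) (f g : (Fin n → ℝ) → ℝ)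
    (x : Fin n → ℝ) : ℝ :=
  ∫ y, f (x + y) * g (x + y) ∂ρ - (∫ y, f (x + y) ∂ρ) * ∫ y, g (x + y) ∂ρ

namespace IsSmoothTest

variable {n : ℕ} {I J : Finset (Fin n)} {L B : ℝ} {f g : (Fin n → ℝ) → ℝ}
  {a b : (Fin n → ℝ) → (Fin n → ℝ) →L[ℝ] ℝ}

/-- Iterating the law of total covariance along a convolution semigroup. -/
lemma shiftCov_le_nsmul {ρ : ℕ → Measure (Fin n → ℝ)} [∀ k, IsProbabilityMeasure (ρ k)]
    (h0 : ρ 0 = Measure.dirac 0) (hadd : ∀ k, ρ (k + 1) = ρ k ∗ ρ 1) {η : ℝ}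
    (hη : ∀ f g a b x, IsSmoothTest I L B f a → IsSmoothTest J L B g b →
      shiftCov (ρ 1) f g x ≤ η) (k : ℕ) :
    ∀ f g a b x, IsSmoothTest I L B f a → IsSmoothTest J L B g b →
      shiftCov (ρ k) f g x ≤ k * η := by
  induction k with
  | zero => intro f g a b x hf hg; simp [shiftCov, h0]
  | succ k ih =>
    intro f g a b x hf hg
    have hPf := hf.average (ρ 1)
    have hPg := hg.average (ρ 1)
    have conv : ∀ {K : Finset (Fin n)} {h c}, IsSmoothTest K L B h c →
        ∫ y, h (x + y) ∂(ρ (k + 1)) = ∫ y, ∫ z, h (x + y + z) ∂(ρ 1) ∂(ρ k) :=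
      fun {K h c} hh => by
        rw [hadd, integral_conv (hh.integrable _ (by fun_prop))]
        simp only [add_assoc]
    have convmul : ∫ y, f (x + y) * g (x + y) ∂(ρ (k + 1)) =
        ∫ y, ∫ z, f (x + y + z) * g (x + y + z) ∂(ρ 1) ∂(ρ k) := by
      rw [hadd, integral_conv (hf.integrable_mul hg _ (φ := fun y => x + y) (by fun_prop))]
      simp only [add_assoc]
    have hmulc : Continuous fun x => ∫ z, f (x + z) * g (x + z) ∂(ρ 1) := by
      refine continuous_of_dominated (bound := fun _ => 1)
        (fun x => ((hf.cont.comp (by fun_prop)).mul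
          (hg.cont.comp (by fun_prop))).aestronglyMeasurable)
        (fun x => ae_of_all _ fun y => ?_) (integrable_const _)
        (ae_of_all _ fun y => (hf.cont.comp (by fun_prop)).mul (hg.cont.comp (by fun_prop)))
      rw [Real.norm_eq_abs, abs_of_nonneg (mul_nonneg (hf.nonneg _) (hg.nonneg _))]
      exact mul_le_one₀ (hf.le_one _) (hg.nonneg _) (hg.le_one _)
    have hI := hPf.integrable_mul hPg (ρ k) (φ := fun y => x + y) (by fun_prop)
    have step : ∫ y, ∫ z, f (x + y + z) * g (x + y + z) ∂(ρ 1) ∂(ρ k) ≤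
        ∫ y, ((∫ z, f (x + y + z) ∂(ρ 1)) * (∫ z, g (x + y + z) ∂(ρ 1)) + η) ∂(ρ k) := by
      refine integral_mono ?_ (hI.add (integrable_const η)) fun y => ?_
      · refine Integrable.of_bound (hmulc.comp (by fun_prop)).aestronglyMeasurable 1 <|
          ae_of_all _ fun y => ?_
        have := norm_integral_le_of_norm_le_const (μ := ρ 1)
          (f := fun z => f (x + y + z) * g (x + y + z)) (C := 1) (ae_of_all _ fun z => by
            rw [Real.norm_eq_abs, abs_of_nonneg (mul_nonneg (hf.nonneg _) (hg.nonneg _))]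
            exact mul_le_one₀ (hf.le_one _) (hg.nonneg _) (hg.le_one _))
        simpa using this
      · have := hη f g a b (x + y) hf hg
        unfold shiftCov at this
        dsimp only
        linarith
    rw [integral_add hI (integrable_const η)] at step
    have hk := ih _ _ _ _ x hPf hPg
    unfold shiftCov at hk ⊢
    rw [conv hf, conv hg, convmul]
    simp only [integral_const, probReal_univ, smul_eq_mul, one_mul] at step
    push_cast
    linarith

/-- Second-order expansion of the covariance under a small centered perturbation. -/
lemma shiftCov_map_smul_le (hf : IsSmoothTest I L B f a) (hg : IsSmoothTest J L B g b)
    (hB : 0 ≤ B) {ν : Measure (Fin n → ℝ)} [IsProbabilityMeasure ν]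
    (hm : ∀ k : ℕ, Integrable (fun y => ‖y‖ ^ k) ν)
    (hmul : ∀ i j, Integrable (fun y => y i * y j) ν)
    (hmean : ∀ T : (Fin n → ℝ) →L[ℝ] ℝ, ∫ y, T y ∂ν = 0) {κ : ℝ} (hκ0 : 0 ≤ κ)
    (hκ : ∀ i ∈ I, ∀ j ∈ J, |∫ y, y i * y j ∂ν| ≤ κ) {h : ℝ} (h0 : 0 ≤ h) (h1 : h ≤ 1)
    (x : Fin n → ℝ) :
    shiftCov (ν.map (h • ·)) f g x ≤ h ^ 2 * (κ * L ^ 2) +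
      h ^ 3 * (2 * L * B * ∫ y, ‖y‖ ^ 3 ∂ν + B ^ 2 * ∫ y, ‖y‖ ^ 4 ∂ν
        + (B * ∫ y, ‖y‖ ^ 2 ∂ν) ^ 2) := by
  have hL := hf.slope_nonneg
  have hφ : Continuous fun y : Fin n → ℝ => x + h • y := by fun_prop
  have hsm : AEMeasurable (fun y : Fin n → ℝ => h • y) ν := by fun_prop
  have rem : ∀ {K : Finset (Fin n)} {q c}, IsSmoothTest K L B q c → ∀ y,
      |q (x + h • y) - q x - h * c x y| ≤ B * h ^ 2 * ‖y‖ ^ 2 := fun {K q c} hq y => by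
    have := hq.taylor x (h • y)
    rw [norm_smul, Real.norm_eq_abs, abs_of_nonneg h0, map_smul, smul_eq_mul] at this
    linarith
  have mean : ∀ {K : Finset (Fin n)} {q c}, IsSmoothTest K L B q c →
      |∫ y, q (x + h • y) ∂ν - q x| ≤ B * h ^ 2 * ∫ y, ‖y‖ ^ 2 ∂ν := fun {K q c} hq => by
    have hT : Integrable (fun y => c x y) ν :=
      ((hm 1).const_mul L).mono' (c x).continuous.aestronglyMeasurable
        (ae_of_all _ fun y => by simpa using hq.abs_deriv_le x y)
    have e : ∫ y, q (x + h • y) ∂ν - q x = ∫ y, (q (x + h • y) - q x - h * c x y) ∂ν := by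
      rw [integral_sub (f := fun y => q (x + h • y) - q x)
        ((hq.integrable ν hφ).sub (integrable_const _)) (hT.const_mul h),
        integral_sub (hq.integrable ν hφ) (integrable_const _), integral_const_mul, hmean]
      simp
    rw [e, ← integral_const_mul]
    exact norm_integral_le_of_norm_le ((hm 2).const_mul _) (ae_of_all _ fun y => by
      rw [Real.norm_eq_abs]; exact rem hq y)
  have hfi := hf.integrable ν hφ
  have hgi := hg.integrable ν hφ
  have hfg := hf.integrable_mul hg ν hφ
  have point : ∀ y, (f (x + h • y) - f x) * (g (x + h • y) - g x) ≤
      h ^ 2 * (a x y * b x y) + (h ^ 3 * (2 * L * B) * ‖y‖ ^ 3 + h ^ 3 * B ^ 2 * ‖y‖ ^ 4) :=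
    fun y => by
    have hr := rem hf y
    have hs := rem hg y
    set r := f (x + h • y) - f x - h * a x y with hrdef
    set s := g (x + h • y) - g x - h * b x y with hsdef
    have ha := hf.abs_deriv_le x y
    have hb := hg.abs_deriv_le x y
    have e : (f (x + h • y) - f x) * (g (x + h • y) - g x) =
        h ^ 2 * (a x y * b x y) + (h * (a x y * s) + h * (r * b x y) + r * s) := by
      rw [hrdef, hsdef]; ring
    have t1 : a x y * s ≤ L * ‖y‖ * (B * h ^ 2 * ‖y‖ ^ 2) := by
      refine (le_abs_self _).trans ?_
      rw [abs_mul]; gcongr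
    have t2 : r * b x y ≤ B * h ^ 2 * ‖y‖ ^ 2 * (L * ‖y‖) := by
      refine (le_abs_self _).trans ?_
      rw [abs_mul]; gcongr
    have t3 : r * s ≤ B * h ^ 2 * ‖y‖ ^ 2 * (B * h ^ 2 * ‖y‖ ^ 2) := by
      refine (le_abs_self _).trans ?_
      rw [abs_mul]; gcongr
    have t4 : h ^ 4 * (B ^ 2 * ‖y‖ ^ 4) ≤ h ^ 3 * (B ^ 2 * ‖y‖ ^ 4) :=
      mul_le_mul_of_nonneg_right (pow_le_pow_of_le_one h0 h1 (by norm_num)) (by positivity)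
    have t1' := mul_le_mul_of_nonneg_left t1 h0
    have t2' := mul_le_mul_of_nonneg_left t2 h0
    rw [e]
    linarith
  have hab : Integrable (fun y => a x y * b x y) ν :=
    ((hm 2).const_mul (L ^ 2)).mono'
      ((a x).continuous.mul (b x).continuous).aestronglyMeasurable
      (ae_of_all _ fun y => by
        rw [norm_mul, Real.norm_eq_abs, Real.norm_eq_abs]
        calc |a x y| * |b x y| ≤ (L * ‖y‖) * (L * ‖y‖) := by
              gcongr
              · exact hf.abs_deriv_le x y
              · exact hg.abs_deriv_le x y
          _ = L ^ 2 * ‖y‖ ^ 2 := by ring)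
  have main : ∫ y, (f (x + h • y) - f x) * (g (x + h • y) - g x) ∂ν ≤
      h ^ 2 * (κ * L ^ 2) + (h ^ 3 * (2 * L * B) * ∫ y, ‖y‖ ^ 3 ∂ν +
        h ^ 3 * B ^ 2 * ∫ y, ‖y‖ ^ 4 ∂ν) := by
    have i3 := (hm 3).const_mul (h ^ 3 * (2 * L * B))
    have i4 := (hm 4).const_mul (h ^ 3 * B ^ 2)
    have hint : Integrable (fun y => (f (x + h • y) - f x) * (g (x + h • y) - g x)) ν := by
      have : Integrable (fun y => f (x + h • y) * g (x + h • y) - f x * g (x + h • y)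
          - g x * f (x + h • y) + f x * g x) ν :=
        ((hfg.sub (hgi.const_mul _)).sub (hfi.const_mul _)).add (integrable_const _)
      exact this.congr (ae_of_all _ fun y => by ring)
    refine (integral_mono hint ((hab.const_mul (h ^ 2)).add (i3.add i4)) point).trans ?_
    simp only [Pi.add_apply]
    rw [integral_add (hab.const_mul (h ^ 2))
      (g := fun y => h ^ 3 * (2 * L * B) * ‖y‖ ^ 3 + h ^ 3 * B ^ 2 * ‖y‖ ^ 4) (i3.add i4),
      integral_add i3 i4, integral_const_mul, integral_const_mul, integral_const_mul]
    have := mul_le_mul_of_nonneg_left (hf.integral_deriv_mul_le hg hmul hκ hκ0 x) (sq_nonneg h)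
    linarith
  have expand : ∫ y, (f (x + h • y) - f x) * (g (x + h • y) - g x) ∂ν =
      ∫ y, f (x + h • y) * g (x + h • y) ∂ν - f x * ∫ y, g (x + h • y) ∂ν
        - g x * ∫ y, f (x + h • y) ∂ν + f x * g x := by
    rw [← integral_const_mul, ← integral_const_mul, ← integral_sub hfg (hgi.const_mul _),
      ← integral_sub (f := fun y => f (x + h • y) * g (x + h • y) - f x * g (x + h • y))
        (hfg.sub (hgi.const_mul _)) (hfi.const_mul _)]
    have : f x * g x = ∫ _, f x * g x ∂ν := by simp
    rw [this, ← integral_add (f := fun y => f (x + h • y) * g (x + h • y) - f x * g (x + h • y)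
      - g x * f (x + h • y)) ((hfg.sub (hgi.const_mul _)).sub (hfi.const_mul _))
      (integrable_const _)]
    exact integral_congr_ae (ae_of_all _ fun y => by ring)
  have prod : -((∫ y, f (x + h • y) ∂ν - f x) * (∫ y, g (x + h • y) ∂ν - g x)) ≤
      h ^ 3 * (B * ∫ y, ‖y‖ ^ 2 ∂ν) ^ 2 := by
    refine (neg_le_abs _).trans ?_
    have hM : 0 ≤ ∫ y, ‖y‖ ^ 2 ∂ν := integral_nonneg fun y => by positivity
    rw [abs_mul]
    calc _ ≤ (B * h ^ 2 * ∫ y, ‖y‖ ^ 2 ∂ν) * (B * h ^ 2 * ∫ y, ‖y‖ ^ 2 ∂ν) :=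
          mul_le_mul (mean hf) (mean hg) (abs_nonneg _) (by positivity)
      _ = h ^ 4 * (B * ∫ y, ‖y‖ ^ 2 ∂ν) ^ 2 := by ring
      _ ≤ _ := mul_le_mul_of_nonneg_right (pow_le_pow_of_le_one h0 h1 (by norm_num))
          (by positivity)
  have hx : Continuous fun y : Fin n → ℝ => x + y := by fun_prop
  unfold shiftCov
  rw [integral_map hsm (f := fun y => f (x + y) * g (x + y)) ((hf.cont.comp hx).mul (hg.cont.comp hx)).aestronglyMeasurable,
    integral_map hsm (f := fun y => f (x + y)) (hf.cont.comp hx).aestronglyMeasurable,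
    integral_map hsm (f := fun y => g (x + y)) (hg.cont.comp hx).aestronglyMeasurable]
  linarith

end IsSmoothTest

/-- Scaling a centered Gaussian measure by square roots gives a convolution semigroup. -/
lemma map_sqrt_smul_conv {E : Type*} [NormedAddCommGroup E] [NormedSpace ℝ E] [CompleteSpace E]
    [SecondCountableTopology E] [MeasurableSpace E] [BorelSpace E] (ν : Measure E) [IsGaussian ν]
    (hν : ν[id] = 0) {s t : ℝ} (hs : 0 ≤ s) (ht : 0 ≤ t) :
    ν.map (√s • ·) ∗ ν.map (√t • ·) = ν.map (√(s + t) • ·) := by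
  have key : ∀ {r : ℝ}, 0 ≤ r → ∀ T : StrongDual ℝ E,
      charFunDual (ν.map (√r • ·)) T = Complex.exp (-(r * Var[T; ν] / 2 : ℝ)) := by
    intro r hr T
    have e : (fun x : E => √r • x) = ⇑(√r • ContinuousLinearMap.id ℝ E) := by ext; simp
    rw [e, charFunDual_map, IsGaussian.charFunDual_eq_of_integral_eq_zero hν]
    have : Var[⇑(T.comp (√r • ContinuousLinearMap.id ℝ E)); ν] = r * Var[T; ν] := by
      rw [← Real.sq_sqrt hr, ← variance_const_mul, Real.sq_sqrt hr]
      congr 1; ext y; simp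
    rw [this]
    push_cast
    congr 1; ring
  have hp : ∀ r : ℝ, IsProbabilityMeasure (ν.map (√r • ·)) := fun r =>
    Measure.isProbabilityMeasure_map (by fun_prop)
  have := hp s
  have := hp t
  have := hp (s + t)
  refine Measure.ext_of_charFunDual ?_
  ext T
  rw [charFunDual_conv, key hs, key ht, key (add_nonneg hs ht), ← Complex.exp_add]
  push_cast
  congr 1; ring

/-- The covariance inequality for smooth test functions of a centered Gaussian vector. -/
lemma IsSmoothTest.shiftCov_gaussian_le {n : ℕ} {I J : Finset (Fin n)} {L B : ℝ}
    {f g : (Fin n → ℝ) → ℝ} {a b : (Fin n → ℝ) → (Fin n → ℝ) →L[ℝ] ℝ}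
    (hf : IsSmoothTest I L B f a) (hg : IsSmoothTest J L B g b) (hB : 0 ≤ B)
    (ν : Measure (Fin n → ℝ)) [IsGaussian ν] (hν : ν[id] = 0) {κ : ℝ} (hκ0 : 0 ≤ κ)
    (hκ : ∀ i ∈ I, ∀ j ∈ J, |∫ y, y i * y j ∂ν| ≤ κ) (x : Fin n → ℝ) :
    shiftCov ν f g x ≤ κ * L ^ 2 := by
  have hm : ∀ k : ℕ, Integrable (fun y => ‖y‖ ^ k) ν := fun k => by
    rcases eq_or_ne k 0 with rfl | hk
    · simp
    · exact (IsGaussian.memLp_id ν k (by simp)).integrable_norm_pow hk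
  have hcoord : ∀ i, MemLp (fun y : Fin n → ℝ => y i) 2 ν := fun i =>
    IsGaussian.memLp_dual ν (ContinuousLinearMap.proj i) 2 (by simp)
  have hmul : ∀ i j, Integrable (fun y : Fin n → ℝ => y i * y j) ν := fun i j =>
    (hcoord i).integrable_mul (hcoord j)
  have hmean : ∀ T : (Fin n → ℝ) →L[ℝ] ℝ, ∫ y, T y ∂ν = 0 := fun T => by
    rw [IsGaussian.integral_dual]
    simp only [id_eq] at hν
    simp [hν]
  set C := 2 * L * B * ∫ y, ‖y‖ ^ 3 ∂ν + B ^ 2 * ∫ y, ‖y‖ ^ 4 ∂ν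
        + (B * ∫ y, ‖y‖ ^ 2 ∂ν) ^ 2 with hC
  have bound : ∀ N : ℕ, shiftCov ν f g x ≤ κ * L ^ 2 + C * √(1 / ((N : ℝ) + 1)) := by
    intro N
    set t : ℝ := 1 / ((N : ℝ) + 1) with ht
    have ht0 : 0 < t := by positivity
    have ht1 : t ≤ 1 := by rw [ht, div_le_one (by positivity)]; linarith [N.cast_nonneg (α := ℝ)]
    have hNt : ((N + 1 : ℕ) : ℝ) * t = 1 := by rw [ht]; push_cast; field_simp
    let ρ : ℕ → Measure (Fin n → ℝ) := fun k => ν.map (√(k * t) • ·)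
    have hρ : ∀ k, IsProbabilityMeasure (ρ k) := fun k =>
      Measure.isProbabilityMeasure_map (by fun_prop)
    have key := IsSmoothTest.shiftCov_le_nsmul (I := I) (J := J) (L := L) (B := B) (ρ := ρ)
      (by simp [ρ]) (fun k => by
        simp only [ρ]
        rw [map_sqrt_smul_conv ν hν (by positivity) (by positivity)]
        push_cast
        rw [add_mul])
      (η := t * (κ * L ^ 2) + √t ^ 3 * C)
      (fun f g a b x hf hg => by
        have := hf.shiftCov_map_smul_le hg hB hm hmul hmean hκ0 hκ (Real.sqrt_nonneg t)
          (Real.sqrt_le_one.mpr ht1) x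
        rw [← hC, Real.sq_sqrt ht0.le] at this
        simpa [ρ] using this) (N + 1) f g a b x hf hg
    have e : ρ (N + 1) = ν := by simp only [ρ]; rw [hNt]; simp
    rw [e, mul_add, ← mul_assoc, hNt, one_mul] at key
    have e2 : ((N + 1 : ℕ) : ℝ) * (√t ^ 3 * C) = C * √t := by
      have : √t ^ 3 = t * √t := by rw [pow_succ, Real.sq_sqrt ht0.le]
      rw [this]
      linear_combination C * √t * hNt
    rwa [e2] at key
  have lim : Filter.Tendsto (fun N : ℕ => κ * L ^ 2 + C * √(1 / ((N : ℝ) + 1))) Filter.atTop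
      (nhds (κ * L ^ 2 + C * √0)) :=
    ((tendsto_one_div_add_atTop_nhds_zero_nat.sqrt).const_mul C).const_add _
  have := ge_of_tendsto' lim bound
  simpa using this

lemma nonneg_of_forall_neg_mul_sq_le {s C : ℝ} (hC : 0 ≤ C)
    (h : ∀ t > 0, -(C * t ^ 2) ≤ t * s) : 0 ≤ s := by
  by_contra! hs
  have h1 : 0 < -s / (C + 1) := div_pos (by linarith) (by linarith)
  have h2 := h _ h1
  have h3 : (-s / (C + 1)) * (C + 1) = -s := div_mul_cancel₀ _ (by linarith)
  set t := -s / (C + 1)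
  nlinarith [mul_pos h1 h1]

/-- An increasing event `A` is separated from the complement of `A - ε𝟙` by a smooth test
function of slope `2 / ε`. -/
lemma exists_isSmoothTest {n : ℕ} {A : Set (Fin n → ℝ)} {I : Finset (Fin n)}
    (hA : IncreasingEvent A) (hAI : SupportedOn A ↑I) (hne : A.Nonempty) {ε : ℝ} (hε : 0 < ε) :
    ∃ F a B, 0 ≤ B ∧ IsSmoothTest I (2 / ε) B F a ∧ (∀ x ∈ A, F x = 1) ∧
      ∀ x, F x ≠ 0 → (fun i => x i + ε) ∈ A := by
  have shift : ∀ v : Fin n → ℝ, (∀ i ∈ I, 0 ≤ v i) → ∀ y ∈ A, y + v ∈ A := fun v hv y hy => by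
    rw [hAI (y + v) (y + fun i => max (v i) 0) fun i hi => by simp [hv i hi]]
    exact hA y hy _ fun i => le_max_right _ _
  have dist_anti : ∀ v : Fin n → ℝ, (∀ i ∈ I, 0 ≤ v i) → ∀ x,
      Metric.infDist (x + v) A ≤ Metric.infDist x A := fun v hv x => by
    refine le_of_forall_gt fun r hr => ?_
    obtain ⟨y, hy, hxy⟩ := (Metric.infDist_lt_iff hne).1 hr
    exact (Metric.infDist_le_dist_of_mem (shift v hv y hy)).trans_lt (by simpa using hxy)
  set L := 2 / ε with hL
  have hL0 : 0 < L := by positivity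
  have hLε : L * ε = 2 := by rw [hL]; field_simp
  let f : (Fin n → ℝ) → ℝ := fun x => max (min (3 / 2 - L * Metric.infDist x A) 1) 0
  have f_nonneg : ∀ x, 0 ≤ f x := fun x => le_max_right _ _
  have f_le_one : ∀ x, f x ≤ 1 := fun x => max_le (min_le_right _ _) zero_le_one
  have f_mono : ∀ v : Fin n → ℝ, (∀ i ∈ I, 0 ≤ v i) → ∀ x, f x ≤ f (x + v) := fun v hv x => by
    have := mul_le_mul_of_nonneg_left (dist_anti v hv x) hL0.le
    exact max_le_max (min_le_min (by linarith) le_rfl) le_rfl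
  have f_lip : ∀ x y, |f x - f y| ≤ L * ‖x - y‖ := fun x y => by
    refine (abs_max_sub_max_le_abs _ _ _).trans ((abs_inf_sub_inf_le_abs _ _ _).trans ?_)
    have h1 := Metric.infDist_le_infDist_add_dist (s := A) (x := x) (y := y)
    have h2 := Metric.infDist_le_infDist_add_dist (s := A) (x := y) (y := x)
    rw [dist_comm] at h2
    rw [show 3 / 2 - L * Metric.infDist x A - (3 / 2 - L * Metric.infDist y A) =
      L * (Metric.infDist y A - Metric.infDist x A) by ring, abs_mul, abs_of_pos hL0,
      ← dist_eq_norm]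
    gcongr
    rw [abs_le]; constructor <;> linarith
  have f_cont : Continuous f := by
    have := Metric.continuous_infDist_pt A
    fun_prop
  let φ : ContDiffBump (0 : Fin n → ℝ) := ⟨ε / 8, ε / 4, by positivity, by linarith⟩
  set w := φ.normed volume
  have w_cont : Continuous w := φ.continuous_normed
  have w_supp : HasCompactSupport w := φ.hasCompactSupport_normed
  have w_nonneg : ∀ t, 0 ≤ w t := φ.nonneg_normed
  have w_diff : ContDiff ℝ 1 w := φ.contDiff_normed (n := 1)
  have w_int : ∫ t, w t = 1 := φ.integral_normed
  have w_integrable : Integrable w := φ.integrable_normed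
  have dw_cont : Continuous (fderiv ℝ w) := w_diff.continuous_fderiv (by norm_num)
  have dw_supp : HasCompactSupport (fderiv ℝ w) := w_supp.fderiv ℝ
  have dw_integrable : Integrable (fderiv ℝ w) := dw_cont.integrable_of_hasCompactSupport dw_supp
  let F : (Fin n → ℝ) → ℝ := convolution w f (ContinuousLinearMap.lsmul ℝ ℝ) volume
  let a : (Fin n → ℝ) → (Fin n → ℝ) →L[ℝ] ℝ := fun x => ∫ t, f (x - t) • fderiv ℝ w t
  have F_eq : ∀ x, F x = ∫ t, w t * f (x - t) := fun x => rfl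
  have F_integrable : ∀ x, Integrable fun t => w t * f (x - t) := fun x =>
    (w_cont.mul (f_cont.comp (by fun_prop))).integrable_of_hasCompactSupport w_supp.mul_right
  have a_integrable : ∀ x, Integrable fun t => f (x - t) • fderiv ℝ w t := fun x =>
    ((f_cont.comp (by fun_prop)).smul dw_cont).integrable_of_hasCompactSupport dw_supp.smul_left
  have F_deriv : ∀ x, HasFDerivAt F (a x) x := fun x => by
    have := w_supp.hasFDerivAt_convolution_left (ContinuousLinearMap.lsmul ℝ ℝ) w_diff
      (f_cont.locallyIntegrable (μ := volume)) x
    refine this.congr_fderiv ?_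
    change ∫ t, (ContinuousLinearMap.lsmul ℝ ℝ).precompL (Fin n → ℝ) (fderiv ℝ w t) (f (x - t)) =
      ∫ t, f (x - t) • fderiv ℝ w t
    refine integral_congr_ae (ae_of_all _ fun t => ?_)
    ext v
    simp [mul_comm]
  have F_mono : ∀ v : Fin n → ℝ, (∀ i ∈ I, 0 ≤ v i) → ∀ x, F x ≤ F (x + v) := fun v hv x => by
    rw [F_eq, F_eq]
    refine integral_mono (F_integrable x) (F_integrable _) fun t => ?_
    have := f_mono v hv (x - t)
    rw [← add_sub_right_comm] at this
    exact mul_le_mul_of_nonneg_left this (w_nonneg t)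
  have F_slope : ∀ v x, F (x + v) ≤ F x + L * ‖v‖ := fun v x => by
    have e : L * ‖v‖ = ∫ t, w t * (L * ‖v‖) := by rw [integral_mul_const, w_int, one_mul]
    rw [e, F_eq, F_eq, ← integral_add (F_integrable x) (w_integrable.mul_const _)]
    refine integral_mono (F_integrable _) ((F_integrable x).add (w_integrable.mul_const _))
      fun t => ?_
    have := (le_abs_self _).trans (f_lip (x + v - t) (x - t))
    rw [show x + v - t - (x - t) = v by abel] at this
    have := mul_le_mul_of_nonneg_left this (w_nonneg t)
    linarith
  set B := L * ∫ t, ‖fderiv ℝ w t‖ with hB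
  have hB0 : 0 ≤ B := mul_nonneg hL0.le (integral_nonneg fun t => norm_nonneg _)
  have a_lip : ∀ x y, ‖a x - a y‖ ≤ B * ‖x - y‖ := fun x y => by
    simp only [a]
    rw [← integral_sub (a_integrable x) (a_integrable y), hB,
      show (L * ∫ t, ‖fderiv ℝ w t‖) * ‖x - y‖ = ∫ t, (L * ‖x - y‖) * ‖fderiv ℝ w t‖ by
        rw [integral_const_mul]; ring]
    refine norm_integral_le_of_norm_le (dw_integrable.norm.const_mul _) (ae_of_all _ fun t => ?_)
    rw [show f (x - t) • fderiv ℝ w t - f (y - t) • fderiv ℝ w t =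
      (f (x - t) - f (y - t)) • fderiv ℝ w t from (sub_smul _ _ _).symm, norm_smul,
      Real.norm_eq_abs]
    have := f_lip (x - t) (y - t)
    rw [sub_sub_sub_cancel_right] at this
    gcongr
  have taylor : ∀ x v, |F (x + v) - F x - a x v| ≤ B * ‖v‖ ^ 2 := fun x v => by
    have := (convex_closedBall x ‖v‖).norm_image_sub_le_of_norm_hasFDerivWithin_le'
      (f := F) (f' := a) (φ := a x) (C := B * ‖v‖) (x := x) (y := x + v)
      (fun z _ => (F_deriv z).hasFDerivWithinAt)
      (fun z hz => (a_lip z x).trans (by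
        rw [mem_closedBall_iff_norm] at hz
        gcongr)) (by simp) (by simp)
    rw [add_sub_cancel_left, Real.norm_eq_abs] at this
    linarith
  refine ⟨F, a, B, hB0, ⟨fun x => ?_, fun x => ?_, ?_, ?_, fun x v hv => ?_, fun x => ?_, taylor⟩,
    fun x hx => ?_, fun x => ?_⟩
  · exact integral_nonneg fun t => mul_nonneg (w_nonneg t) (f_nonneg _)
  · rw [F_eq, ← w_int]
    exact integral_mono (F_integrable x) w_integrable fun t =>
      mul_le_of_le_one_right (w_nonneg t) (f_le_one _)
  · exact continuous_iff_continuousAt.2 fun x => (F_deriv x).continuousAt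
  · exact (LipschitzWith.of_dist_le_mul (K := ⟨B, hB0⟩) fun x y => by
      rw [dist_eq_norm, dist_eq_norm]; exact a_lip x y).continuous
  · refine nonneg_of_forall_neg_mul_sq_le (C := B * ‖v‖ ^ 2) (by positivity) fun t ht => ?_
    have h1 := (abs_le.1 (taylor x (t • v))).2
    have h2 := F_mono (t • v) (fun i hi => mul_nonneg ht.le (hv i hi)) x
    rw [norm_smul, mul_pow, Real.norm_eq_abs, sq_abs, map_smul, smul_eq_mul] at h1
    linarith
  · rw [← sub_nonneg]
    refine nonneg_of_forall_neg_mul_sq_le (C := B) (by positivity) fun t ht => ?_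
    have h1 := (abs_le.1 (taylor x (t • 1))).1
    have h2 := F_slope (t • 1) x
    have h3 : ‖t • (1 : Fin n → ℝ)‖ ≤ t := by
      rw [pi_norm_le_iff_of_nonneg ht.le]
      intro i; simp [abs_of_pos ht]
    have h4 : B * ‖t • (1 : Fin n → ℝ)‖ ^ 2 ≤ B * t ^ 2 := by gcongr
    have h5 := mul_le_mul_of_nonneg_left h3 hL0.le
    rw [map_smul, smul_eq_mul] at h1
    linarith
  · have one : ∀ y ∈ Metric.ball x φ.rOut, f y = 1 := fun y hy => by
      have h1 := Metric.infDist_le_dist_of_mem (x := y) hx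
      have h2 : dist y x < ε / 4 := hy
      have h3 := mul_le_mul_of_nonneg_left (h1.trans h2.le) hL0.le
      have h4 : min (3 / 2 - L * Metric.infDist y A) 1 = 1 := min_eq_right (by linarith)
      simp only [f, h4]
      exact max_eq_left zero_le_one
    have hx1 := one x (Metric.mem_ball_self φ.rOut_pos)
    have := φ.normed_convolution_eq_right (μ := volume) (g := f) (x₀ := x)
      fun y hy => (one y hy).trans hx1.symm
    exact this.trans hx1
  · contrapose!
    intro hxA
    have far : ε ≤ Metric.infDist x A := by
      refine (Metric.le_infDist hne).2 fun y hy => ?_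
      by_contra! hlt
      refine hxA ?_
      have := shift (fun i => x i + ε - y i) (fun i _ => by
        have h1 := (dist_le_pi_dist x y i).trans_lt hlt
        rw [Real.dist_eq, abs_lt] at h1
        linarith) y hy
      convert this using 1
      ext i; simp
    have zero : ∀ y ∈ Metric.ball x φ.rOut, f y = 0 := fun y hy => by
      have h1 := Metric.infDist_le_infDist_add_dist (s := A) (x := x) (y := y)
      have h2 : dist y x < ε / 4 := hy
      rw [dist_comm] at h2
      have h3 : 3 / 4 * ε ≤ Metric.infDist y A := by linarith
      have h4 := mul_le_mul_of_nonneg_left h3 hL0.le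
      exact max_eq_right ((min_le_left _ _).trans (by linarith))
    have hx0 := zero x (Metric.mem_ball_self φ.rOut_pos)
    have := φ.normed_convolution_eq_right (μ := volume) (g := f) (x₀ := x)
      fun y hy => (zero y hy).trans hx0.symm
    exact this.trans hx0

lemma IsSmoothTest.mono {n : ℕ} {I : Finset (Fin n)} {L B B' : ℝ} {f : (Fin n → ℝ) → ℝ}
    {a : (Fin n → ℝ) → (Fin n → ℝ) →L[ℝ] ℝ} (hf : IsSmoothTest I L B f a) (hB : B ≤ B') :
    IsSmoothTest I L B' f a :=
  { hf with taylor := fun x v => (hf.taylor x v).trans (by gcongr) }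

lemma kNorm_nonneg {n : ℕ} (K : Fin n → Fin n → ℝ) (I J : Finset (Fin n)) : 0 ≤ kNorm K I J :=
  Real.sSup_nonneg <| by rintro _ ⟨i, _, j, _, rfl⟩; exact abs_nonneg _

lemma abs_le_kNorm {n : ℕ} (K : Fin n → Fin n → ℝ) {I J : Finset (Fin n)} {i j : Fin n}
    (hi : i ∈ I) (hj : j ∈ J) : |K i j| ≤ kNorm K I J := by
  refine le_csSup (Set.Finite.bddAbove ?_) ⟨i, hi, j, hj, rfl⟩
  refine (Set.finite_range fun p : Fin n × Fin n => |K p.1 p.2|).subset ?_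
  rintro _ ⟨i, _, j, _, rfl⟩
  exact ⟨(i, j), rfl⟩

namespace IsGaussianVector

variable {Ω : Type*} [MeasureSpace Ω] {n : ℕ} {X : Ω → Fin n → ℝ}

lemma aemeasurable_s5 (hX : IsGaussianVector X) : AEMeasurable X ℙ := by
  refine aemeasurable_pi_iff.2 fun i => ?_
  obtain ⟨m, v, h⟩ := hX (Pi.single i 1)
  have : AEMeasurable (fun ω => ∑ j, (Pi.single i 1 : Fin n → ℝ) j * X ω j) ℙ :=
    AEMeasurable.of_map_ne_zero (by rw [h]; exact IsProbabilityMeasure.ne_zero _)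
  simpa [Pi.single_apply] using this

lemma isGaussian_map_s5 (hX : IsGaussianVector X) : IsGaussian (Measure.map X ℙ) := by
  refine isGaussian_of_map_eq_gaussianReal fun T => ?_
  obtain ⟨m, v, h⟩ := hX fun i => T (Pi.single i 1)
  refine ⟨m, v, ?_⟩
  rw [← h, AEMeasurable.map_map_of_aemeasurable (by fun_prop) hX.aemeasurable_s5]
  congr 1
  ext ω
  simp only [Function.comp_apply]
  conv_lhs => rw [pi_eq_sum_univ' (X ω), map_sum]
  exact Finset.sum_congr rfl fun i _ => by rw [map_smul, smul_eq_mul, mul_comm]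

end IsGaussianVector

theorem stmt5 :
    ∃ c : ℝ, 0 < c ∧
      ∀ (n : ℕ) (Ω : Type) (_ : MeasureSpace Ω)
        (_ : IsProbabilityMeasure (ℙ : Measure Ω))
        (X : Ω → Fin n → ℝ), IsGaussianVector X →
        ∀ (K : Fin n → Fin n → ℝ),
          (∀ i j, K i j = ∫ ω, X ω i * X ω j ∂ℙ -
            (∫ ω, X ω i ∂ℙ) * (∫ ω, X ω j ∂ℙ)) →
        ∀ (I1 I2 : Finset (Fin n)) (A1 A2 : Set (Fin n → ℝ)),
          IncreasingEvent A1 → IncreasingEvent A2 →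
          SupportedOn A1 ↑I1 → SupportedOn A2 ↑I2 →
          ∀ ε : ℝ, 0 < ε →
            (ℙ {ω | X ω ∈ A1 ∩ A2}).toReal -
                (ℙ {ω | (fun i => X ω i + ε) ∈ A1}).toReal *
                  (ℙ {ω | (fun i => X ω i + ε) ∈ A2}).toReal ≤
              c * kNorm K I1 I2 / ε ^ 2 := by
  refine ⟨4, by norm_num, ?_⟩
  intro n Ω _ _ X hX K hK I1 I2 A1 A2 hA1 hA2 hI1 hI2 ε hε
  have hκ0 := kNorm_nonneg K I1 I2
  rcases (A1 ∩ A2).eq_empty_or_nonempty with hempty | ⟨x₀, hx₀1, hx₀2⟩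
  · have h1 : 0 ≤ 4 * kNorm K I1 I2 / ε ^ 2 := by positivity
    have h2 : 0 ≤ (ℙ {ω | (fun i => X ω i + ε) ∈ A1}).toReal *
        (ℙ {ω | (fun i => X ω i + ε) ∈ A2}).toReal := by positivity
    simp only [hempty, Set.mem_empty_iff_false, Set.ofPred_false, measure_empty,
      ENNReal.toReal_zero]
    linarith
  obtain ⟨F, a, B, hB, hF, hF1, hF0⟩ := exists_isSmoothTest hA1 hI1 ⟨x₀, hx₀1⟩ hε
  obtain ⟨G, b, B', hB', hG, hG1, hG0⟩ := exists_isSmoothTest hA2 hI2 ⟨x₀, hx₀2⟩ hε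
  have hXm := hX.aemeasurable_s5
  have hμ := hX.isGaussian_map_s5
  have hXi : ∀ i, MemLp (fun ω => X ω i) 2 ℙ := fun i => by
    have := IsGaussian.memLp_dual (Measure.map X ℙ) (ContinuousLinearMap.proj i) 2 (by simp)
    exact (memLp_map_measure_iff (by fun_prop) hXm).1 this
  set m : Fin n → ℝ := fun i => ∫ ω, X ω i with hm
  have hYm : AEMeasurable (fun ω => X ω - m) ℙ := hXm.sub_const m
  set ν := Measure.map (fun ω => X ω - m) ℙ with hν
  have hνG : IsGaussian ν := by
    have e : ν = (Measure.map X ℙ).map (fun x => x - m) := by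
      rw [AEMeasurable.map_map_of_aemeasurable (by fun_prop) hXm]; rfl
    rw [e]
    infer_instance
  have hν0 : ν[id] = 0 := by
    ext i
    have e := IsGaussian.integral_dual (μ := ν)
      (ContinuousLinearMap.proj (R := ℝ) (φ := fun _ : Fin n => ℝ) i)
    change ContinuousLinearMap.proj (R := ℝ) (φ := fun _ : Fin n => ℝ) i (∫ y, y ∂ν) = 0
    rw [← e]
    change ∫ y, y i ∂ν = 0
    rw [integral_map hYm (continuous_apply i).aestronglyMeasurable]
    simp only [Pi.sub_apply]
    rw [integral_sub ((hXi i).integrable (by norm_num)) (integrable_const _)]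
    simp [hm]
  have hcov : ∀ i j, ∫ y, y i * y j ∂ν = K i j := fun i j => by
    rw [integral_map hYm (by fun_prop), hK]
    exact covariance_eq_sub (hXi i) (hXi j)
  have key := (hF.mono (le_max_left B B')).shiftCov_gaussian_le (hG.mono (le_max_right B B'))
    (hB.trans (le_max_left _ _)) ν hν0 hκ0
    (fun i hi j hj => by rw [hcov]; exact abs_le_kNorm K hi hj) m
  have hmc : Continuous fun y : Fin n → ℝ => m + y := by fun_prop
  have hFc := hF.cont
  have hGc := hG.cont
  unfold shiftCov at key
  rw [hν, integral_map hYm (f := fun y => F (m + y) * G (m + y)) (by fun_prop),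
    integral_map hYm (f := fun y => F (m + y)) (by fun_prop),
    integral_map hYm (f := fun y => G (m + y)) (by fun_prop)] at key
  simp only [add_sub_cancel] at key
  have integrable_comp : ∀ {H : (Fin n → ℝ) → ℝ}, Continuous H → (∀ x, 0 ≤ H x) →
      (∀ x, H x ≤ 1) → Integrable (fun ω => H (X ω)) ℙ := fun hH h0 h1 =>
    Integrable.of_bound (hH.measurable.comp_aemeasurable hXm).aestronglyMeasurable 1
      (ae_of_all _ fun ω => by rw [Real.norm_eq_abs, abs_of_nonneg (h0 _)]; exact h1 _)
  have lower : (ℙ {ω | X ω ∈ A1 ∩ A2}).toReal ≤ ∫ ω, F (X ω) * G (X ω) := by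
    have hsub : {ω | X ω ∈ A1 ∩ A2} ⊆ {ω | 1 ≤ F (X ω) * G (X ω)} := fun ω hω => by
      simp [hF1 _ hω.1, hG1 _ hω.2]
    have hM := mul_meas_ge_le_integral_of_nonneg (μ := ℙ) (f := fun ω => F (X ω) * G (X ω))
      (ae_of_all _ fun ω => mul_nonneg (hF.nonneg _) (hG.nonneg _))
      (integrable_comp (hFc.mul hGc) (fun x => mul_nonneg (hF.nonneg x) (hG.nonneg x))
        fun x => mul_le_one₀ (hF.le_one x) (hG.nonneg x) (hG.le_one x)) 1
    rw [one_mul] at hM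
    exact (measureReal_mono hsub).trans hM
  have upper : ∀ {H : (Fin n → ℝ) → ℝ} {A : Set (Fin n → ℝ)}, Continuous H → (∀ x, 0 ≤ H x) →
      (∀ x, H x ≤ 1) → (∀ x, H x ≠ 0 → (fun i => x i + ε) ∈ A) →
      ∫ ω, H (X ω) ≤ (ℙ {ω | (fun i => X ω i + ε) ∈ A}).toReal := fun {H A} hH h0 h1 hA => by
    set S := {ω | (fun i => X ω i + ε) ∈ A}
    have hS := measurableSet_toMeasurable (ℙ : Measure Ω) S
    calc ∫ ω, H (X ω) ≤ ∫ ω, (toMeasurable ℙ S).indicator 1 ω := by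
          refine integral_mono (integrable_comp hH h0 h1)
            ((integrable_const (1 : ℝ)).indicator hS) fun ω => ?_
          by_cases hω : ω ∈ toMeasurable ℙ S
          · simpa [hω] using h1 (X ω)
          · have : H (X ω) = 0 := by
              by_contra hne
              exact hω (subset_toMeasurable _ _ (hA _ hne))
            simp [hω, this]
      _ = (ℙ S).toReal := by
          rw [integral_indicator_one hS, measureReal_def, measure_toMeasurable]
  have u1 := upper hFc hF.nonneg hF.le_one hF0
  have u2 := upper hGc hG.nonneg hG.le_one hG0
  have hprod := mul_le_mul u1 u2 (integral_nonneg fun ω => hG.nonneg (X ω)) ENNReal.toReal_nonneg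
  have e : kNorm K I1 I2 * (2 / ε) ^ 2 = 4 * kNorm K I1 I2 / ε ^ 2 := by ring
  rw [e] at key
  linarith
end
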